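/- arXiv:2512.03325 — 2 statements merged into one kernel-verified Lean document; each statement's English description precedes it below -/
import Mathlib

section
/- Operator-norm bound for the matrix of degree-k Hermite random features (Lemma F.6). Fix an integer k ≥ 3 and constants C₀, D₀ > 0. There exist constants C, K > 0 depending only on k, C₀, D₀ such that for any d ≥ C and any n, p with 1 ≤ n, p ≤ C₀d²: if w₁,…,w_p are i.i.d. uniform on the unit sphere S^{d−1} and x₁,…,x_n are i.i.d. N(0, I_d), independent of each other, and Z_k ∈ ℝ^{p×n} is the matrix with entries (Z_k)_{ij} := He_k(⟨w_i, x_j⟩), then with probability at least 1 − d^{−D₀}, ‖Z_k‖_op ≤ (log d)^K · d. -/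
/-!
Operator-norm bound for the matrix of degree-`k` Hermite random features (Lemma F.6).
-/

noncomputable section

open MeasureTheory ProbabilityTheory

/-- The degree-`k` orthonormal probabilist's Hermite polynomial. -/
def He (k : ℕ) (x : ℝ) : ℝ :=
  (Polynomial.aeval x (Polynomial.hermite k)) / Real.sqrt (Nat.factorial k)

/-- Euclidean dot product on `ι → ℝ`. -/
def dotp {ι : Type*} [Fintype ι] (u v : ι → ℝ) : ℝ := ∑ i, u i * v i

/-- Euclidean norm on `ι → ℝ`. -/
def enorm2 {ι : Type*} [Fintype ι] (u : ι → ℝ) : ℝ := Real.sqrt (∑ i, (u i) ^ 2)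

/-- The standard Gaussian measure on `ι → ℝ`. -/
def stdG (ι : Type*) [Fintype ι] : Measure (ι → ℝ) :=
  Measure.pi fun _ => gaussianReal 0 1

/-- The uniform distribution on the unit sphere of `ι → ℝ`. -/
def unifSphere (ι : Type*) [Fintype ι] : Measure (ι → ℝ) :=
  (stdG ι).map fun x => (enorm2 x)⁻¹ • x

/-- The `ℓ² → ℓ²` operator norm of a matrix. -/
def opNorm {ι κ : Type*} [Fintype ι] [Fintype κ] (A : ι → κ → ℝ) : ℝ :=
  ⨆ v : {v : κ → ℝ // (∑ j, (v j) ^ 2) ≤ 1},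
    Real.sqrt (∑ i, (∑ j, A i j * v.1 j) ^ 2)

section Helpers
open Matrix

lemma spec_decomp {ι : Type*} [Fintype ι] [DecidableEq ι] (S : Matrix ι ι ℝ) (hS : S.PosSemidef) :
    ∃ (l : ι → ℝ) (u : ι → ι → ℝ), (∀ a, 0 ≤ l a) ∧ (∀ z : ι → ℝ, ∑ a, (u a ⬝ᵥ z) ^ 2 = z ⬝ᵥ z) ∧
      (∀ a, u a ⬝ᵥ u a = 1) ∧
      (∀ (m : ℕ) (z : ι → ℝ), z ⬝ᵥ (S ^ m *ᵥ z) = ∑ a, l a ^ m * (u a ⬝ᵥ z) ^ 2) ∧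
      (∀ m : ℕ, (S ^ m).trace = ∑ a, l a ^ m) := by
  classical
  set U : Matrix ι ι ℝ := (hS.1.eigenvectorUnitary : Matrix ι ι ℝ) with hU
  have hUU : Uᵀ * U = 1 := by
    have := Unitary.coe_star_mul_self hS.1.eigenvectorUnitary
    simpa [Matrix.star_eq_conjTranspose] using this
  have hUU' : U * Uᵀ = 1 := by
    have := Unitary.coe_mul_star_self hS.1.eigenvectorUnitary
    simpa [Matrix.star_eq_conjTranspose] using this
  have hsp : S = U * diagonal hS.1.eigenvalues * Uᵀ := by
    have := hS.1.spectral_theorem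
    rw [Unitary.conjStarAlgAut_apply] at this
    simpa [Matrix.star_eq_conjTranspose, Function.comp_def] using this
  have hpow : ∀ m : ℕ, S ^ m = U * diagonal (fun a => hS.1.eigenvalues a ^ m) * Uᵀ := by
    intro m
    induction m with
    | zero => simp [hUU']
    | succ m ih =>
      rw [pow_succ, ih]
      calc _ = (U * diagonal (fun a => hS.1.eigenvalues a ^ m) * Uᵀ) *
            (U * diagonal hS.1.eigenvalues * Uᵀ) := by rw [← hsp]
        _ = U * diagonal (fun a => hS.1.eigenvalues a ^ m) * (Uᵀ * U) *
            diagonal hS.1.eigenvalues * Uᵀ := by simp only [Matrix.mul_assoc]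
        _ = _ := by
          rw [hUU, Matrix.mul_one, Matrix.mul_assoc U, diagonal_mul_diagonal]
          simp only [pow_succ]
  have hform : ∀ (m : ℕ) (z : ι → ℝ), z ⬝ᵥ (S ^ m *ᵥ z) =
      ∑ a, hS.1.eigenvalues a ^ m * ((fun a => U.col a) a ⬝ᵥ z) ^ 2 := by
    intro m z
    rw [hpow, ← mulVec_mulVec, ← mulVec_mulVec, dotProduct_mulVec, ← mulVec_transpose]
    have : ∀ a, (Uᵀ *ᵥ z) a = U.col a ⬝ᵥ z := fun a => rfl
    simp only [dotProduct, mulVec_diagonal]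
    refine Finset.sum_congr rfl fun a _ => ?_
    rw [this, dotProduct]; ring
  refine ⟨hS.1.eigenvalues, fun a => U.col a, hS.eigenvalues_nonneg, ?_, ?_, hform, ?_⟩
  · intro z
    have := hform 0 z
    simpa using this.symm
  · intro a
    have := congrFun (congrFun hUU a) a
    simpa [Matrix.mul_apply, dotProduct, Matrix.col] using this
  · intro m
    rw [hpow, trace_mul_comm, ← Matrix.mul_assoc, hUU, Matrix.one_mul, trace_diagonal]

lemma young_pow (x b : ℝ) (hx : 0 ≤ x) (hb : 0 < b) (i N : ℕ) (hi : i ≤ N) (hN : 0 < N) :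
    x ^ i * b ^ (N - i) ≤ (i / N : ℝ) * x ^ N + (1 - i / N) * b ^ N := by
  have hN' : (0:ℝ) < N := by exact_mod_cast hN
  have h := Real.geom_mean_le_arith_mean2_weighted (w₁ := (i/N : ℝ)) (w₂ := 1 - i/N)
    (p₁ := x ^ N) (p₂ := b ^ N) (by positivity)
    (by rw [sub_nonneg, div_le_one hN']; exact_mod_cast hi) (by positivity) (by positivity) (by ring)
  convert h using 2
  · rw [← Real.rpow_natCast x N, ← Real.rpow_mul hx, mul_div_cancel₀ _ hN'.ne', Real.rpow_natCast]
  · rw [← Real.rpow_natCast b N, ← Real.rpow_mul hb.le, mul_sub, mul_div_cancel₀ _ hN'.ne', mul_one,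
      ← Real.rpow_natCast, Nat.cast_sub hi]

lemma interp {ι : Type*} [Fintype ι] (l q : ι → ℝ) (hl : ∀ a, 0 ≤ l a) (hq : ∀ a, 0 ≤ q a)
    (R b : ℝ) (hb : 0 < b) (N : ℕ) (hN : 0 < N) (h0 : ∑ a, q a ≤ R)
    (h1 : ∑ a, l a ^ N * q a ≤ R * b ^ N) (i : ℕ) (hi : i ≤ N) :
    ∑ a, l a ^ i * q a ≤ R * b ^ i := by
  have hN' : (0:ℝ) < N := by exact_mod_cast hN
  have hiN : (i:ℝ) / N ≤ 1 := by rw [div_le_one hN']; exact_mod_cast hi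
  have hi0 : (0:ℝ) ≤ i / N := by positivity
  have hbp : 0 < b ^ (N - i) := by positivity
  have hbN : 0 < b ^ N := by positivity
  have key : (∑ a, l a ^ i * q a) * b ^ (N - i) ≤ R * b ^ i * b ^ (N - i) := by
    calc (∑ a, l a ^ i * q a) * b ^ (N - i) = ∑ a, (l a ^ i * b ^ (N - i)) * q a := by
          rw [Finset.sum_mul]; exact Finset.sum_congr rfl fun a _ => by ring
      _ ≤ ∑ a, ((i / N : ℝ) * l a ^ N + (1 - i / N) * b ^ N) * q a := by
          gcongr with a _
          · exact hq a
          · exact young_pow _ _ (hl a) hb i N hi hN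
      _ = (i / N : ℝ) * (∑ a, l a ^ N * q a) + (1 - i / N) * b ^ N * ∑ a, q a := by
          rw [Finset.mul_sum, Finset.mul_sum, ← Finset.sum_add_distrib]
          exact Finset.sum_congr rfl fun a _ => by ring
      _ ≤ (i / N : ℝ) * (R * b ^ N) + (1 - i / N) * b ^ N * R := by
          gcongr
      _ = R * b ^ N := by ring
      _ = R * b ^ i * b ^ (N - i) := by rw [mul_assoc, ← pow_add, Nat.add_sub_cancel' hi]
  exact le_of_mul_le_mul_right key hbp

lemma pow_add_rank_one {ι : Type*} [Fintype ι] [DecidableEq ι] (S : Matrix ι ι ℝ) (z : ι → ℝ) (i : ℕ) :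
    z ⬝ᵥ ((S + vecMulVec z z) ^ i *ᵥ z) = z ⬝ᵥ (S ^ i *ᵥ z) +
      ∑ j ∈ Finset.range i, (z ⬝ᵥ (S ^ j *ᵥ z)) * (z ⬝ᵥ ((S + vecMulVec z z) ^ (i - 1 - j) *ᵥ z)) := by
  have h : ∀ i : ℕ, (S + vecMulVec z z) ^ i = S ^ i +
      ∑ j ∈ Finset.range i, S ^ j * vecMulVec z z * (S + vecMulVec z z) ^ (i - 1 - j) := by
    intro i
    induction i with
    | zero => simp
    | succ i ih =>
      rw [Finset.sum_range_succ', pow_succ']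
      simp only [pow_zero, one_mul, Nat.sub_zero, Nat.add_sub_cancel]
      have e : ∀ j, i - 1 - j = i - (j + 1) := fun j => by omega
      simp only [e] at ih
      conv_lhs => rw [add_mul]
      rw [← add_assoc]
      congr 1
      nth_rewrite 1 [ih]
      rw [mul_add, pow_succ', Finset.mul_sum]
      congr 1
      exact Finset.sum_congr rfl fun j _ => by rw [pow_succ']; simp only [mul_assoc]
  nth_rewrite 1 [h i]
  rw [add_mulVec, dotProduct_add, sum_mulVec, dotProduct_sum]
  congr 1
  refine Finset.sum_congr rfl fun j _ => ?_
  rw [← mulVec_mulVec, ← mulVec_mulVec]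
  have : ∀ y : ι → ℝ, vecMulVec z z *ᵥ y = (z ⬝ᵥ y) • z := by
    intro y; ext a; simp [mulVec, dotProduct, vecMulVec_apply, Finset.sum_mul]
    exact Finset.sum_congr rfl fun j _ => by ring
  rw [this, mulVec_smul, dotProduct_smul, smul_eq_mul, mul_comm]

lemma rank_one_pow_le {ι : Type*} [Fintype ι] [DecidableEq ι] (S : Matrix ι ι ℝ) (hS : S.PosSemidef)
    (z : ι → ℝ) (R b : ℝ) (hR : 0 < R) (hb : 0 < b) (N : ℕ) (hN : 0 < N) (hz : z ⬝ᵥ z ≤ R)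
    (h1 : z ⬝ᵥ (S ^ N *ᵥ z) ≤ R * b ^ N) :
    z ⬝ᵥ ((S + vecMulVec z z) ^ N *ᵥ z) ≤ R * (R + b) ^ N := by
  obtain ⟨l, u, hl, hu, -, hf, -⟩ := spec_decomp S hS
  have ha : ∀ i ≤ N, z ⬝ᵥ (S ^ i *ᵥ z) ≤ R * b ^ i := by
    intro i hi
    rw [hf]
    refine interp l (fun a => (u a ⬝ᵥ z) ^ 2) hl (fun a => sq_nonneg _) R b hb N hN ?_ ?_ i hi
    · rw [hu]; exact hz
    · rw [← hf]; exact h1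
  have ha0 : ∀ i, 0 ≤ z ⬝ᵥ (S ^ i *ᵥ z) := by
    intro i; rw [hf]; exact Finset.sum_nonneg fun a _ => mul_nonneg (pow_nonneg (hl a) _) (sq_nonneg _)
  suffices H : ∀ i ≤ N, z ⬝ᵥ ((S + vecMulVec z z) ^ i *ᵥ z) ≤ R * (R + b) ^ i from H N le_rfl
  intro i
  induction i using Nat.strong_induction_on with
  | _ i ih =>
    intro hi
    rw [pow_add_rank_one]
    calc _ ≤ R * b ^ i + ∑ j ∈ Finset.range i, (R * b ^ j) * (R * (R + b) ^ (i - 1 - j)) := by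
          refine add_le_add (ha i hi) (Finset.sum_le_sum fun j hj => ?_)
          · have := Finset.mem_range.1 hj
            exact mul_le_mul_of_nonneg (ha j (by omega)) (ih _ (by omega) (by omega)) (ha0 j) (by positivity)
      _ = R * (R + b) ^ i := by
          have := (Commute.all b (R + b)).geom_sum₂_mul i
          have e : ∑ j ∈ Finset.range i, (R * b ^ j) * (R * (R + b) ^ (i - 1 - j)) =
              R * (R * ∑ j ∈ Finset.range i, b ^ j * (R + b) ^ (i - 1 - j)) := by
            rw [Finset.mul_sum, Finset.mul_sum]; exact Finset.sum_congr rfl fun j _ => by ring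
          rw [e]
          linear_combination (-R) * this

lemma rank_one_pow_le' {ι : Type*} [Fintype ι] [DecidableEq ι] (S : Matrix ι ι ℝ) (hS : S.PosSemidef)
    (z : ι → ℝ) (R : ℝ) (hR : 0 < R) (N : ℕ) (hz : z ⬝ᵥ z ≤ R) :
    z ⬝ᵥ ((S + vecMulVec z z) ^ N *ᵥ z) ≤
      Real.exp 1 * (z ⬝ᵥ (S ^ N *ᵥ z)) + R * ((N + 2) * R) ^ N := by
  have he : 1 ≤ Real.exp 1 := Real.one_le_exp (by norm_num)
  obtain ⟨l, u, hl, hu, -, hf, -⟩ := spec_decomp S hS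
  have ha0 : 0 ≤ z ⬝ᵥ (S ^ N *ᵥ z) := by
    rw [hf]; exact Finset.sum_nonneg fun a _ => mul_nonneg (pow_nonneg (hl a) _) (sq_nonneg _)
  rcases Nat.eq_zero_or_pos N with rfl | hN
  · simp at ha0 ⊢; nlinarith
  by_cases hc : z ⬝ᵥ (S ^ N *ᵥ z) ≤ R * ((N + 1) * R) ^ N
  · have := rank_one_pow_le S hS z R ((N + 1) * R) hR (by positivity) N hN hz hc
    have e : R + (N + 1) * R = (N + 2) * R := by ring
    rw [e] at this
    nlinarith [mul_nonneg (Real.exp_pos 1).le ha0]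
  · push Not at hc
    set A := z ⬝ᵥ (S ^ N *ᵥ z) with hA
    have hAR : 0 ≤ A / R := by positivity
    set b := (A / R) ^ ((N:ℝ)⁻¹) with hb
    have hbN : b ^ N = A / R := Real.rpow_inv_natCast_pow hAR hN.ne'
    have hb0 : 0 ≤ b := by positivity
    have hbb : (N + 1) * R < b := by
      refine lt_of_pow_lt_pow_left₀ N hb0 ?_
      rw [hbN, lt_div_iff₀ hR]; linarith
    have hRb : R * b ^ N = A := by rw [hbN]; field_simp
    have hbpos : 0 < b := lt_of_le_of_lt (by positivity) hbb
    have := rank_one_pow_le S hS z R b hR hbpos N hN hz (by rw [hRb])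
    refine this.trans ?_
    have h2 : (R + b) ^ N ≤ Real.exp 1 * b ^ N := by
      have h3 : R + b ≤ b * Real.exp ((N:ℝ)⁻¹) := by
        have := Real.add_one_le_exp ((N:ℝ)⁻¹)
        have hN' : (0:ℝ) < N := by exact_mod_cast hN
        have h4 : R ≤ b * (N:ℝ)⁻¹ := by
          rw [← div_eq_mul_inv, le_div_iff₀ hN']; nlinarith
        nlinarith
      calc (R + b) ^ N ≤ (b * Real.exp ((N:ℝ)⁻¹)) ^ N := by gcongr
        _ = _ := by
          rw [mul_pow, ← Real.exp_nat_mul, mul_inv_cancel₀ (by exact_mod_cast hN.ne')]; ring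
    have : 0 ≤ R * ((N + 2) * R) ^ N := by positivity
    nlinarith


def sumMat {ι κ : Type*} [Fintype κ] (z : κ → ι → ℝ) : Matrix ι ι ℝ := ∑ j, vecMulVec (z j) (z j)

lemma sumMat_posSemidef {ι κ : Type*} [Fintype ι] [Fintype κ] (z : κ → ι → ℝ) :
    (sumMat z).PosSemidef := by
  refine posSemidef_sum _ fun j _ => ?_
  simpa using posSemidef_vecMulVec_self_star (z j)

lemma trace_sumMat_pow {ι κ : Type*} [Fintype ι] [DecidableEq ι] [Fintype κ] (z : κ → ι → ℝ) (m : ℕ) :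
    (sumMat z ^ (m + 1)).trace = ∑ j, z j ⬝ᵥ (sumMat z ^ m *ᵥ z j) := by
  rw [pow_succ]
  nth_rewrite 2 [sumMat]
  rw [Matrix.mul_sum, trace_sum]
  refine Finset.sum_congr rfl fun j _ => ?_
  rw [mul_vecMulVec, trace_vecMulVec, dotProduct_comm]

lemma form_nonneg {ι : Type*} [Fintype ι] [DecidableEq ι] (S : Matrix ι ι ℝ) (hS : S.PosSemidef)
    (m : ℕ) (z : ι → ℝ) : 0 ≤ z ⬝ᵥ (S ^ m *ᵥ z) := by
  obtain ⟨l, u, hl, hu, -, hf, -⟩ := spec_decomp S hS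
  rw [hf]; exact Finset.sum_nonneg fun a _ => mul_nonneg (pow_nonneg (hl a) _) (sq_nonneg _)

lemma measurable_pow_entry {Ω ι : Type*} [MeasurableSpace Ω] [Fintype ι] [DecidableEq ι]
    (S : Ω → Matrix ι ι ℝ) (hS : ∀ a b, Measurable fun ω => S ω a b) (m : ℕ) :
    ∀ a b, Measurable fun ω => (S ω ^ m) a b := by
  induction m with
  | zero => intro a b; simp
  | succ m ih =>
    intro a b
    simp only [pow_succ, Matrix.mul_apply]
    exact Finset.measurable_sum _ fun c _ => (ih a c).mul (hS c b)

lemma measurable_sumMat {Ω ι κ : Type*} [MeasurableSpace Ω] [Fintype κ]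
    (z : Ω → κ → ι → ℝ) (hz : ∀ j a, Measurable fun ω => z ω j a) (a b : ι) :
    Measurable fun ω => sumMat (z ω) a b := by
  simp only [sumMat, Matrix.sum_apply, vecMulVec_apply]
  exact Finset.measurable_sum _ fun c _ => (hz c a).mul (hz c b)

lemma measurable_trace_pow {Ω ι κ : Type*} [MeasurableSpace Ω] [Fintype ι] [DecidableEq ι] [Fintype κ]
    (z : Ω → κ → ι → ℝ) (hz : ∀ j a, Measurable fun ω => z ω j a) (m : ℕ) :
    Measurable fun ω => (sumMat (z ω) ^ m).trace := by
  simp only [Matrix.trace, Matrix.diag]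
  exact Finset.measurable_sum _ fun c _ => measurable_pow_entry _ (measurable_sumMat z hz) m c c

lemma measurable_form {Ω ι : Type*} [MeasurableSpace Ω] [Fintype ι]
    (S : Ω → Matrix ι ι ℝ) (hS : ∀ a b, Measurable fun ω => S ω a b) (z : Ω → ι → ℝ)
    (hz : ∀ a, Measurable fun ω => z ω a) :
    Measurable fun ω => z ω ⬝ᵥ (S ω *ᵥ z ω) := by
  simp only [dotProduct, mulVec]
  exact Finset.measurable_sum _ fun c _ => (hz c).mul
    (Finset.measurable_sum _ fun e _ => (hS c e).mul (hz e))

lemma lintegral_form_le {Ω ι : Type*} [MeasurableSpace Ω] [Fintype ι] [DecidableEq ι]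
    (μ : Measure Ω) (z : Ω → ι → ℝ)
    (hz : ∀ a, Measurable fun ω => z ω a) (σ : ℝ) (hσ : 0 ≤ σ)
    (hcov : ∀ v : ι → ℝ, ∫⁻ ω, ENNReal.ofReal ((v ⬝ᵥ z ω) ^ 2) ∂μ ≤ ENNReal.ofReal (σ * (v ⬝ᵥ v)))
    (S : Matrix ι ι ℝ) (hS : S.PosSemidef) (m : ℕ) :
    ∫⁻ ω, ENNReal.ofReal (z ω ⬝ᵥ (S ^ m *ᵥ z ω)) ∂μ ≤ ENNReal.ofReal (σ * (S ^ m).trace) := by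
  obtain ⟨l, u, hl, hu, hu1, hf, ht⟩ := spec_decomp S hS
  have hm : ∀ a, Measurable fun ω => ENNReal.ofReal ((u a ⬝ᵥ z ω) ^ 2) := by
    intro a
    refine ENNReal.measurable_ofReal.comp (Measurable.pow_const ?_ 2)
    simp only [dotProduct]
    exact Finset.measurable_sum _ fun c _ => (hz c).const_mul _
  simp only [hf, ht]
  have e : ∀ ω, ENNReal.ofReal (∑ a, l a ^ m * (u a ⬝ᵥ z ω) ^ 2) =
      ∑ a, ENNReal.ofReal (l a ^ m) * ENNReal.ofReal ((u a ⬝ᵥ z ω) ^ 2) := by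
    intro ω
    rw [ENNReal.ofReal_sum_of_nonneg fun a _ => mul_nonneg (pow_nonneg (hl a) _) (sq_nonneg _)]
    exact Finset.sum_congr rfl fun a _ => ENNReal.ofReal_mul (pow_nonneg (hl a) _)
  simp only [e]
  rw [lintegral_finsetSum _ fun a _ => (hm a).const_mul _, Finset.mul_sum,
    ENNReal.ofReal_sum_of_nonneg fun a _ => mul_nonneg hσ (pow_nonneg (hl a) _)]
  refine Finset.sum_le_sum fun a _ => ?_
  rw [lintegral_const_mul _ (hm a)]
  calc _ ≤ ENNReal.ofReal (l a ^ m) * ENNReal.ofReal (σ * (u a ⬝ᵥ u a)) := by gcongr; exact hcov _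
    _ = _ := by rw [hu1, ← ENNReal.ofReal_mul (pow_nonneg (hl a) _)]; congr 1; ring

lemma lintegral_form_le' {Ω ι : Type*} [MeasurableSpace Ω] [Fintype ι] [DecidableEq ι]
    (μ : Measure Ω) (z : Ω → ι → ℝ)
    (hz : ∀ a, Measurable fun ω => z ω a) (σ : ℝ) (hσ : 0 ≤ σ)
    (hcov : ∀ v : ι → ℝ, ∫⁻ ω, ENNReal.ofReal ((v ⬝ᵥ z ω) ^ 2) ∂μ ≤ ENNReal.ofReal (σ * (v ⬝ᵥ v)))
    (S : Matrix ι ι ℝ) (hS : S.PosSemidef) (m : ℕ) (c : ℝ) (hc : 0 ≤ c) :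
    ∫⁻ ω, ENNReal.ofReal c * ENNReal.ofReal (z ω ⬝ᵥ (S ^ m *ᵥ z ω)) ∂μ ≤
      ENNReal.ofReal (c * σ) * ENNReal.ofReal (S ^ m).trace := by
  rw [lintegral_const_mul _ (measurable_form (fun _ => S ^ m) (fun _ _ => measurable_const) z hz).ennreal_ofReal,
    ENNReal.ofReal_mul hc, mul_assoc, ← ENNReal.ofReal_mul hσ]
  gcongr
  exact lintegral_form_le μ z hz σ hσ hcov S hS m

def trMoment {Ω ι : Type*} [MeasurableSpace Ω] [Fintype ι] [DecidableEq ι]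
    (μ : Measure Ω) (z : Ω → ι → ℝ) (m n : ℕ) : ENNReal :=
  ∫⁻ ω, ENNReal.ofReal (sumMat (fun j => z (ω j)) ^ m).trace ∂(Measure.pi fun _ : Fin n => μ)

lemma lintegral_pi_succAbove {Ω : Type*} [MeasurableSpace Ω] (μ : Measure Ω) [IsProbabilityMeasure μ]
    (n : ℕ) (j : Fin (n + 1)) (F : (Fin (n + 1) → Ω) → ENNReal) (hF : Measurable F) :
    ∫⁻ ω, F ω ∂(Measure.pi fun _ : Fin (n + 1) => μ) =
      ∫⁻ x, F (j.insertNth x.1 x.2) ∂(μ.prod (Measure.pi fun _ : Fin n => μ)) := by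
  have hmp := (measurePreserving_piFinSuccAbove (fun _ : Fin (n+1) => μ) j).symm
  rw [← hmp.lintegral_comp hF]
  rfl

lemma sumMat_insertNth {Ω ι : Type*} (z : Ω → ι → ℝ) (n : ℕ) (j : Fin (n + 1)) (x : Ω) (y : Fin n → Ω) :
    sumMat (fun i => z ((j.insertNth x y : Fin (n + 1) → Ω) i)) =
      sumMat (fun i => z (y i)) + vecMulVec (z x) (z x) := by
  simp only [sumMat]
  rw [Fin.sum_univ_succAbove _ j]
  simp [add_comm]

lemma step_two {Ω ι : Type*} [MeasurableSpace Ω] [Fintype ι] [DecidableEq ι]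
    (μ : Measure Ω) [IsProbabilityMeasure μ] (z : Ω → ι → ℝ)
    (hz : ∀ a, Measurable fun ω => z ω a) (σ : ℝ) (hσ : 0 ≤ σ)
    (hcov : ∀ v : ι → ℝ, ∫⁻ ω, ENNReal.ofReal ((v ⬝ᵥ z ω) ^ 2) ∂μ ≤ ENNReal.ofReal (σ * (v ⬝ᵥ v)))
    (m n : ℕ) (c : ℝ) (hc : 0 ≤ c) :
    ∫⁻ x : Ω × (Fin n → Ω), ENNReal.ofReal c *
        ENNReal.ofReal (z x.1 ⬝ᵥ (sumMat (fun j => z (x.2 j)) ^ m *ᵥ z x.1))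
        ∂(μ.prod (Measure.pi fun _ => μ)) ≤ ENNReal.ofReal (c * σ) * trMoment μ z m n := by
  have hzj : ∀ (j : Fin n) (a : ι), Measurable fun ω : Fin n → Ω => z (ω j) a :=
    fun j a => (hz a).comp (measurable_pi_apply j)
  have hm00 : ∀ a b, Measurable fun x : Ω × (Fin n → Ω) => sumMat (fun j => z (x.2 j)) a b :=
    fun a b => (measurable_sumMat (fun (y : Fin n → Ω) j => z (y j)) hzj a b).comp measurable_snd
  have hm01 : ∀ a b, Measurable fun x : Ω × (Fin n → Ω) => (sumMat (fun j => z (x.2 j)) ^ m) a b :=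
    measurable_pow_entry (fun x : Ω × (Fin n → Ω) => sumMat (fun j => z (x.2 j))) hm00 m
  have hm0 : Measurable fun x : Ω × (Fin n → Ω) =>
      z x.1 ⬝ᵥ (sumMat (fun j => z (x.2 j)) ^ m *ᵥ z x.1) := by
    exact measurable_form (fun x : Ω × (Fin n → Ω) => sumMat (fun j => z (x.2 j)) ^ m)
      hm01 (fun x => z x.1) (fun a => (hz a).comp measurable_fst)
  have hm1 := hm0.ennreal_ofReal.const_mul (ENNReal.ofReal c)
  have hmt : Measurable fun y : Fin n → Ω => ENNReal.ofReal (sumMat (fun j => z (y j)) ^ m).trace :=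
    (measurable_trace_pow (fun (ω : Fin n → Ω) j => z (ω j)) hzj m).ennreal_ofReal
  rw [lintegral_prod_symm _ hm1.aemeasurable]
  unfold trMoment
  rw [← lintegral_const_mul _ hmt]
  refine lintegral_mono fun y => ?_
  exact lintegral_form_le' μ z hz σ hσ hcov (sumMat fun j => z (y j)) (sumMat_posSemidef _) m c hc

lemma step_j {Ω ι : Type*} [MeasurableSpace Ω] [Fintype ι] [DecidableEq ι]
    (μ : Measure Ω) [IsProbabilityMeasure μ] (z : Ω → ι → ℝ)
    (hz : ∀ a, Measurable fun ω => z ω a) (σ R : ℝ) (hσ : 0 ≤ σ) (hR : 0 < R)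
    (hcov : ∀ v : ι → ℝ, ∫⁻ ω, ENNReal.ofReal ((v ⬝ᵥ z ω) ^ 2) ∂μ ≤ ENNReal.ofReal (σ * (v ⬝ᵥ v)))
    (hzR : ∀ ω, z ω ⬝ᵥ z ω ≤ R) (m n : ℕ) (j : Fin (n + 1))
    (hmeas : Measurable fun ω : Fin (n + 1) → Ω =>
      z (ω j) ⬝ᵥ (sumMat (fun j => z (ω j)) ^ m *ᵥ z (ω j))) :
    ∫⁻ ω, ENNReal.ofReal (z (ω j) ⬝ᵥ (sumMat (fun j => z (ω j)) ^ m *ᵥ z (ω j)))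
      ∂(Measure.pi fun _ : Fin (n + 1) => μ) ≤
      ENNReal.ofReal (Real.exp 1 * σ) * trMoment μ z m n + ENNReal.ofReal (R * ((m + 2) * R) ^ m) := by
  rw [lintegral_pi_succAbove μ n j _ hmeas.ennreal_ofReal]
  have h1 : ∀ x : Ω × (Fin n → Ω), ENNReal.ofReal (z ((j.insertNth x.1 x.2 : Fin (n + 1) → Ω) j) ⬝ᵥ
      (sumMat (fun i => z ((j.insertNth x.1 x.2 : Fin (n + 1) → Ω) i)) ^ m *ᵥ
        z ((j.insertNth x.1 x.2 : Fin (n + 1) → Ω) j))) ≤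
      ENNReal.ofReal (Real.exp 1) *
        ENNReal.ofReal (z x.1 ⬝ᵥ (sumMat (fun j => z (x.2 j)) ^ m *ᵥ z x.1)) +
        ENNReal.ofReal (R * ((m + 2) * R) ^ m) := by
    intro x
    rw [sumMat_insertNth, Fin.insertNth_apply_same, ← ENNReal.ofReal_mul (Real.exp_pos 1).le,
      ← ENNReal.ofReal_add]
    · exact ENNReal.ofReal_le_ofReal (rank_one_pow_le' _ (sumMat_posSemidef _) _ R hR m (hzR _))
    · exact mul_nonneg (Real.exp_pos 1).le (form_nonneg _ (sumMat_posSemidef _) _ _)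
    · positivity
  refine (lintegral_mono h1).trans ?_
  rw [lintegral_add_right _ measurable_const, lintegral_const, measure_univ, mul_one]
  gcongr
  exact step_two μ z hz σ hσ hcov m n _ (Real.exp_pos 1).le

lemma trMoment_succ {Ω ι : Type*} [MeasurableSpace Ω] [Fintype ι] [DecidableEq ι]
    (μ : Measure Ω) [IsProbabilityMeasure μ] (z : Ω → ι → ℝ)
    (hz : ∀ a, Measurable fun ω => z ω a) (σ R : ℝ) (hσ : 0 ≤ σ) (hR : 0 < R)
    (hcov : ∀ v : ι → ℝ, ∫⁻ ω, ENNReal.ofReal ((v ⬝ᵥ z ω) ^ 2) ∂μ ≤ ENNReal.ofReal (σ * (v ⬝ᵥ v)))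
    (hzR : ∀ ω, z ω ⬝ᵥ z ω ≤ R) (m n : ℕ) :
    trMoment μ z (m + 1) (n + 1) ≤ (n + 1 : ℕ) * (ENNReal.ofReal (Real.exp 1 * σ) * trMoment μ z m n +
      ENNReal.ofReal (R * ((m + 2) * R) ^ m)) := by
  have hzj : ∀ (n : ℕ) (j : Fin n) (a : ι), Measurable fun ω : Fin n → Ω => z (ω j) a :=
    fun n j a => (hz a).comp (measurable_pi_apply j)
  have hmeas : ∀ j : Fin (n+1), Measurable fun ω : Fin (n + 1) → Ω =>
      z (ω j) ⬝ᵥ (sumMat (fun j => z (ω j)) ^ m *ᵥ z (ω j)) := by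
    intro j
    exact measurable_form (fun ω : Fin (n + 1) → Ω => sumMat (fun j => z (ω j)) ^ m)
      (measurable_pow_entry (fun ω : Fin (n + 1) → Ω => sumMat (fun j => z (ω j)))
        (measurable_sumMat (fun (ω : Fin (n + 1) → Ω) j => z (ω j)) (hzj _)) m)
      (fun ω => z (ω j)) (hzj _ j)
  have hpt : ∀ ω : Fin (n+1) → Ω, ENNReal.ofReal (sumMat (fun j => z (ω j)) ^ (m + 1)).trace =
      ∑ j, ENNReal.ofReal (z (ω j) ⬝ᵥ (sumMat (fun j => z (ω j)) ^ m *ᵥ z (ω j))) := by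
    intro ω
    rw [trace_sumMat_pow, ENNReal.ofReal_sum_of_nonneg]
    exact fun j _ => form_nonneg _ (sumMat_posSemidef _) _ _
  have h0 : trMoment μ z (m + 1) (n + 1) = ∑ j, ∫⁻ ω,
      ENNReal.ofReal (z (ω j) ⬝ᵥ (sumMat (fun j => z (ω j)) ^ m *ᵥ z (ω j)))
      ∂(Measure.pi fun _ : Fin (n + 1) => μ) := by
    rw [trMoment, lintegral_congr hpt, lintegral_finsetSum _ fun j _ => (hmeas j).ennreal_ofReal]
  rw [h0, ← nsmul_eq_mul]
  refine (Finset.sum_le_card_nsmul _ _ _ fun j _ =>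
    step_j μ z hz σ R hσ hR hcov hzR m n j (hmeas j)).trans_eq ?_
  rw [Finset.card_univ, Fintype.card_fin]

lemma trMoment_le {Ω ι : Type*} [MeasurableSpace Ω] [Fintype ι] [DecidableEq ι]
    (μ : Measure Ω) [IsProbabilityMeasure μ] (z : Ω → ι → ℝ)
    (hz : ∀ a, Measurable fun ω => z ω a) (σ R : ℝ) (hσ : 0 ≤ σ) (hR : 0 < R)
    (hcov : ∀ v : ι → ℝ, ∫⁻ ω, ENNReal.ofReal ((v ⬝ᵥ z ω) ^ 2) ∂μ ≤ ENNReal.ofReal (σ * (v ⬝ᵥ v)))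
    (hzR : ∀ ω, z ω ⬝ᵥ z ω ≤ R) (M N : ℕ) (L : ℝ) (hL1 : Real.exp 1 * N * σ ≤ L)
    (hL2 : (M + 1) * R ≤ L) :
    ∀ m ≤ M, ∀ n ≤ N, trMoment μ z m n ≤ ENNReal.ofReal ((Fintype.card ι + m * N) * L ^ m) := by
  have hL0 : 0 ≤ L := le_trans (by positivity) hL2
  intro m
  induction m with
  | zero =>
    intro _ n _
    simp [trMoment]
  | succ m ih =>
    intro hm n hn
    cases n with
    | zero => simp [trMoment, sumMat]
    | succ n =>
      refine (trMoment_succ μ z hz σ R hσ hR hcov hzR m n).trans ?_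
      have h1 := ih (by omega) n (by omega)
      calc _ ≤ (N : ENNReal) * (ENNReal.ofReal (Real.exp 1 * σ) *
            ENNReal.ofReal ((Fintype.card ι + m * N) * L ^ m) + ENNReal.ofReal (R * ((m + 2) * R) ^ m)) := by
            gcongr
        _ = ENNReal.ofReal (N * (Real.exp 1 * σ * ((Fintype.card ι + m * N) * L ^ m) + R * ((m + 2) * R) ^ m)) := by
            rw [← ENNReal.ofReal_mul (by positivity), ← ENNReal.ofReal_add (by positivity) (by positivity),
              ENNReal.ofReal_mul (by positivity), ENNReal.ofReal_natCast]
        _ ≤ _ := by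
            apply ENNReal.ofReal_le_ofReal
            have hmM : (m:ℝ) + 1 ≤ M := by exact_mod_cast hm
            have hb : R * ((m + 2) * R) ^ m ≤ L ^ (m + 1) := by
              rw [pow_succ']
              have : ((m:ℝ) + 2) * R ≤ L := le_trans (mul_le_mul_of_nonneg_right (by linarith) hR.le) hL2
              gcongr
              nlinarith [(Nat.cast_nonneg m : (0:ℝ) ≤ m)]
            have hc : N * (Real.exp 1 * σ * ((Fintype.card ι + m * N) * L ^ m)) ≤
                L * ((Fintype.card ι + m * N) * L ^ m) := by
              rw [← mul_assoc]
              gcongr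
              linarith
            have hd := mul_le_mul_of_nonneg_left hb (Nat.cast_nonneg N : (0:ℝ) ≤ N)
            push_cast
            rw [mul_add]
            refine (add_le_add hc hd).trans_eq ?_
            ring

lemma trace_tail {Ω ι : Type*} [MeasurableSpace Ω] [Fintype ι] [DecidableEq ι]
    (μ : Measure Ω) [IsProbabilityMeasure μ] (z : Ω → ι → ℝ)
    (hz : ∀ a, Measurable fun ω => z ω a) (σ R : ℝ) (hσ : 0 ≤ σ) (hR : 0 < R)
    (hcov : ∀ v : ι → ℝ, ∫⁻ ω, ENNReal.ofReal ((v ⬝ᵥ z ω) ^ 2) ∂μ ≤ ENNReal.ofReal (σ * (v ⬝ᵥ v)))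
    (hzR : ∀ ω, z ω ⬝ᵥ z ω ≤ R) (m N : ℕ) (L : ℝ) (hL1 : Real.exp 1 * N * σ ≤ L)
    (hL2 : (m + 1) * R ≤ L) :
    (Measure.pi fun _ : Fin N => μ) {ω | (Real.exp 1 * L) ^ m < (sumMat (fun j => z (ω j)) ^ m).trace} ≤
      ENNReal.ofReal ((Fintype.card ι + m * N) * Real.exp (-m)) := by
  have hL0 : 0 < L := lt_of_lt_of_le (by positivity) hL2
  have h1 := trMoment_le μ z hz σ R hσ hR hcov hzR m N L hL1 hL2 m le_rfl N le_rfl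
  have hpos : 0 < (Real.exp 1 * L) ^ m := by positivity
  have h2 := mul_meas_ge_le_lintegral (μ := Measure.pi fun _ : Fin N => μ)
    (f := fun ω => ENNReal.ofReal (sumMat (fun j => z (ω j)) ^ m).trace)
    (ENNReal.measurable_ofReal.comp (measurable_trace_pow (fun (ω : Fin N → Ω) j => z (ω j))
      (fun j a => (hz a).comp (measurable_pi_apply j)) m)) (ENNReal.ofReal ((Real.exp 1 * L) ^ m))
  have h3 := h2.trans h1
  have h4 : (Fintype.card ι + m * N) * L ^ m = (Real.exp 1 * L) ^ m * ((Fintype.card ι + m * N) * Real.exp (-m)) := by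
    rw [mul_pow, ← Real.exp_nat_mul, mul_one, Real.exp_neg]
    field_simp
  rw [h4, ENNReal.ofReal_mul hpos.le] at h3
  have h5 := (ENNReal.mul_le_mul_iff_right (by simpa using hpos) ENNReal.ofReal_ne_top).1 h3
  refine (measure_mono ?_).trans h5
  intro ω hω
  exact ENNReal.ofReal_le_ofReal (le_of_lt hω)

lemma form_le_of_trace {ι κ : Type*} [Fintype ι] [DecidableEq ι] [Fintype κ] (z : κ → ι → ℝ) (T : ℝ)
    (hT : 0 ≤ T) (m : ℕ) (hm : m ≠ 0) (h : (sumMat z ^ m).trace ≤ T ^ m) (a : κ → ℝ) :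
    ∑ i, (∑ j, a j * z j i) ^ 2 ≤ T * ∑ j, a j ^ 2 := by
  obtain ⟨l, u, hl, hu, -, hf, ht⟩ := spec_decomp (sumMat z) (sumMat_posSemidef z)
  have hlT : ∀ b, l b ≤ T := by
    intro b
    refine le_of_pow_le_pow_left₀ hm hT ?_
    rw [ht] at h
    exact (Finset.single_le_sum (f := fun b => l b ^ m) (fun c _ => pow_nonneg (hl c) m)
      (Finset.mem_univ b)).trans h
  have hq : ∀ v : ι → ℝ, ∑ j, (z j ⬝ᵥ v) ^ 2 ≤ T * (v ⬝ᵥ v) := by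
    intro v
    have h1 := hf 1 v
    have e : v ⬝ᵥ (sumMat z ^ 1 *ᵥ v) = ∑ j, (z j ⬝ᵥ v) ^ 2 := by
      rw [pow_one, sumMat, sum_mulVec, dotProduct_sum]
      refine Finset.sum_congr rfl fun j _ => ?_
      have : vecMulVec (z j) (z j) *ᵥ v = (z j ⬝ᵥ v) • z j := by
        ext a; simp [mulVec, dotProduct, vecMulVec_apply, Finset.sum_mul]
        exact Finset.sum_congr rfl fun j _ => by ring
      rw [this, dotProduct_smul, dotProduct_comm, smul_eq_mul, sq]
    rw [← e, h1, ← hu v, Finset.mul_sum]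
    refine Finset.sum_le_sum fun b _ => ?_
    rw [pow_one]
    exact mul_le_mul_of_nonneg_right (hlT b) (sq_nonneg _)
  set y : ι → ℝ := fun i => ∑ j, a j * z j i with hy
  have hyy : ∑ i, (∑ j, a j * z j i) ^ 2 = y ⬝ᵥ y := by
    simp only [dotProduct, hy, sq]
  rw [hyy]
  have h1 : y ⬝ᵥ y = ∑ j, a j * (z j ⬝ᵥ y) := by
    simp only [dotProduct, Finset.mul_sum]
    rw [Finset.sum_comm]
    refine Finset.sum_congr rfl fun i _ => ?_
    conv_lhs => rw [hy]
    simp only [Finset.sum_mul]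
    exact Finset.sum_congr rfl fun j _ => by ring
  have h2 : (y ⬝ᵥ y) ^ 2 ≤ (∑ j, a j ^ 2) * ∑ j, (z j ⬝ᵥ y) ^ 2 := by
    nth_rewrite 1 [h1]
    exact Finset.sum_mul_sq_le_sq_mul_sq _ _ _
  have h0 : 0 ≤ y ⬝ᵥ y := by
    simp only [dotProduct]; exact Finset.sum_nonneg fun i _ => mul_self_nonneg _
  have ha0 : 0 ≤ ∑ j, a j ^ 2 := Finset.sum_nonneg fun i _ => sq_nonneg _
  have h3 := h2.trans (mul_le_mul_of_nonneg_left (hq y) ha0)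
  rcases h0.eq_or_lt with h | h
  · rw [← h]; positivity
  · refine le_of_mul_le_mul_right ?_ h
    calc _ = (y ⬝ᵥ y) ^ 2 := by ring
      _ ≤ _ := h3
      _ = _ := by ring


lemma gauss_integrable_pow (n : ℕ) : Integrable (fun x : ℝ => x ^ n) (gaussianReal 0 1) := by
  have := (memLp_id_gaussianReal (μ := 0) (v := 1) (n : NNReal)).integrable_norm_pow'
  simp only [id] at this
  refine (integrable_norm_iff (by fun_prop)).1 ?_
  simpa [norm_pow] using this

lemma gauss_moment (n : ℕ) : ∫ x, x ^ (n + 2) ∂(gaussianReal 0 1) =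
    (n + 1) * ∫ x, x ^ n ∂(gaussianReal 0 1) := by
  have hone : (1 : NNReal) ≠ 0 := one_ne_zero
  rw [integral_gaussianReal_eq_integral_smul hone, integral_gaussianReal_eq_integral_smul hone]
  obtain ⟨c, hc⟩ : ∃ c : ℝ, gaussianPDFReal 0 1 = fun x => c * Real.exp (-(1/2) * x ^ 2) := by
    refine ⟨(√(2 * Real.pi * (1 : NNReal)))⁻¹, ?_⟩
    funext x
    simp only [gaussianPDFReal]
    congr 2
    simp only [NNReal.coe_one, sub_zero]; ring
  have hd : ∀ x : ℝ, HasDerivAt (gaussianPDFReal 0 1) (-(x * gaussianPDFReal 0 1 x)) x := by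
    intro x
    rw [hc]
    have h1 : HasDerivAt (fun x : ℝ => -(1/2) * x ^ 2) (-x) x := by
      have := (hasDerivAt_pow 2 x).const_mul (-(1/2) : ℝ)
      refine this.congr_deriv ?_
      norm_num; ring
    refine (h1.exp.const_mul c).congr_deriv ?_
    ring
  have hIntg : ∀ k : ℕ, Integrable (fun x : ℝ => x ^ k * gaussianPDFReal 0 1 x) := by
    intro k
    have h := integrable_rpow_mul_exp_neg_mul_sq (b := 1/2) (by norm_num) (s := (k:ℝ))
      (by have : (0:ℝ) ≤ k := Nat.cast_nonneg k; linarith)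
    refine (h.const_mul c).congr (Filter.Eventually.of_forall fun x => ?_)
    simp only [hc, Real.rpow_natCast]
    ring
  have key := integral_mul_deriv_eq_deriv_mul_of_integrable (u := fun x : ℝ => x ^ (n + 1))
    (v := gaussianPDFReal 0 1) (u' := fun x => ((n + 1 : ℕ) : ℝ) * x ^ n)
    (v' := fun x => -(x * gaussianPDFReal 0 1 x))
    (fun x _ => by simpa using hasDerivAt_pow (n + 1) x) (fun x _ => hd x)
    (by
      refine (hIntg (n + 2)).neg.congr (Filter.Eventually.of_forall fun x => ?_)
      simp only [Pi.neg_apply, Pi.mul_apply]; ring)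
    (by
      refine ((hIntg n).const_mul ((n + 1 : ℕ) : ℝ)).congr (Filter.Eventually.of_forall fun x => ?_)
      simp only [Pi.mul_apply]; ring)
    (by exact hIntg (n + 1))
  simp only [smul_eq_mul]
  rw [← integral_const_mul]
  have e1 : ∫ x : ℝ, x ^ (n + 1) * -(x * gaussianPDFReal 0 1 x) =
      - ∫ x, gaussianPDFReal 0 1 x * x ^ (n + 2) := by
    rw [← integral_neg]; congr 1; ext x; ring
  rw [e1] at key
  rw [neg_inj.1 key]
  congr 1; ext x; push_cast; ring

lemma gauss_moment_one : ∫ x, x ∂(gaussianReal 0 1) = 0 := integral_id_gaussianReal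

instance stdG_prob (ι : Type*) [Fintype ι] : IsProbabilityMeasure (stdG ι) := by
  unfold stdG; infer_instance

lemma eval_monomial_eq {ι : Type*} [Fintype ι] (s : ι →₀ ℕ) (c : ℝ) (g : ι → ℝ) :
    MvPolynomial.eval g (MvPolynomial.monomial s c) = c * ∏ i, g i ^ s i := by
  rw [MvPolynomial.eval_monomial, Finsupp.prod_fintype]; simp

lemma mv_integrable {ι : Type*} [Fintype ι] (P : MvPolynomial ι ℝ) :
    Integrable (fun g => MvPolynomial.eval g P) (stdG ι) := by
  induction P using MvPolynomial.induction_on' with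
  | monomial s c =>
    simp only [eval_monomial_eq]
    refine Integrable.const_mul ?_ c
    exact Integrable.fintype_prod (f := fun i (x : ℝ) => x ^ s i) (fun i => gauss_integrable_pow (s i))
  | add p q hp hq => exact (hp.add hq).congr (Filter.Eventually.of_forall fun g => by simp)

lemma mv_integrable_X {ι : Type*} [Fintype ι] (P : MvPolynomial ι ℝ) (i : ι) :
    Integrable (fun g => g i * MvPolynomial.eval g P) (stdG ι) :=
  (mv_integrable (MvPolynomial.X i * P)).congr (Filter.Eventually.of_forall fun g => by simp)

lemma mv_monomial_integral {ι : Type*} [Fintype ι] (s : ι →₀ ℕ) (c : ℝ) :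
    ∫ g, MvPolynomial.eval g (MvPolynomial.monomial s c) ∂(stdG ι) =
      c * ∏ i, ∫ x, x ^ s i ∂(gaussianReal 0 1) := by
  simp only [eval_monomial_eq]
  rw [integral_const_mul, stdG, integral_fintype_prod_eq_prod (fun i (x : ℝ) => x ^ s i)]

lemma mv_stein {ι : Type*} [Fintype ι] [DecidableEq ι] (P : MvPolynomial ι ℝ) (i : ι) :
    ∫ g, g i * MvPolynomial.eval g P ∂(stdG ι) =
      ∫ g, MvPolynomial.eval g (MvPolynomial.pderiv i P) ∂(stdG ι) := by
  have hI : ∀ P : MvPolynomial ι ℝ, Integrable (fun g => g i * MvPolynomial.eval g P) (stdG ι) := by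
    intro P
    exact mv_integrable_X P i
  induction P using MvPolynomial.induction_on' with
  | monomial s c =>
    have e : ∀ g : ι → ℝ, g i * MvPolynomial.eval g (MvPolynomial.monomial s c) =
        MvPolynomial.eval g (MvPolynomial.monomial (Finsupp.single i 1 + s) c) := by
      intro g
      rw [show MvPolynomial.monomial (Finsupp.single i 1 + s) c =
        MvPolynomial.X i * MvPolynomial.monomial s c by
          rw [MvPolynomial.X, MvPolynomial.monomial_mul, one_mul]]
      simp
    simp only [e]
    rw [MvPolynomial.pderiv_monomial, mv_monomial_integral, mv_monomial_integral,
      ← Finset.mul_prod_erase _ _ (Finset.mem_univ i), ← Finset.mul_prod_erase _ _ (Finset.mem_univ i)]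
    have e2 : ∏ x ∈ Finset.univ.erase i, ∫ y, y ^ (Finsupp.single i 1 + s : ι →₀ ℕ) x ∂(gaussianReal 0 1) =
        ∏ x ∈ Finset.univ.erase i, ∫ y, y ^ (s - Finsupp.single i 1 : ι →₀ ℕ) x ∂(gaussianReal 0 1) := by
      refine Finset.prod_congr rfl fun x hx => ?_
      have := Finset.ne_of_mem_erase hx
      simp [Finsupp.single_apply, this.symm]
    rw [e2]
    have e3 : ∫ y, y ^ (Finsupp.single i 1 + s : ι →₀ ℕ) i ∂(gaussianReal 0 1) =
        (s i : ℝ) * ∫ y, y ^ (s - Finsupp.single i 1 : ι →₀ ℕ) i ∂(gaussianReal 0 1) := by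
      simp only [Finsupp.add_apply, Finsupp.single_eq_same, Finsupp.tsub_apply]
      rcases hs : s i with _ | k
      · simp [gauss_moment_one]
      · rw [show 1 + (k + 1) = k + 2 by ring, gauss_moment]; simp
    rw [e3]; ring
  | add p q hp hq =>
    simp only [map_add, mul_add]
    rw [integral_add (hI p) (hI q), hp, hq, integral_add (mv_integrable _) (mv_integrable _)]

lemma derivative_hermite_succ (n : ℕ) : Polynomial.derivative (Polynomial.hermite (n + 1)) =
    (n + 1 : ℕ) * Polynomial.hermite n := by
  induction n with
  | zero => simp
  | succ n ih =>
    rw [Polynomial.hermite_succ (n + 1), Polynomial.derivative_sub, Polynomial.derivative_mul, ih,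
      Polynomial.derivative_X, Polynomial.derivative_mul, Polynomial.derivative_natCast,
      Polynomial.hermite_succ n]
    push_cast; ring

def linP {ι : Type*} [Fintype ι] (a : ι → ℝ) : MvPolynomial ι ℝ :=
  ∑ i, MvPolynomial.C (a i) * MvPolynomial.X i

lemma eval_linP {ι : Type*} [Fintype ι] (a g : ι → ℝ) : MvPolynomial.eval g (linP a) = dotp a g := by
  simp [linP, dotp]

lemma eval_herm {ι : Type*} [Fintype ι] (a g : ι → ℝ) (P : Polynomial ℤ) :
    MvPolynomial.eval g (Polynomial.aeval (linP a) P) = Polynomial.aeval (dotp a g) P := by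
  rw [← eval_linP, Polynomial.aeval_def, Polynomial.aeval_def, Polynomial.hom_eval₂]
  congr 1
  exact RingHom.ext_int _ _

lemma pderiv_herm {ι : Type*} [Fintype ι] [DecidableEq ι] (a : ι → ℝ) (P : Polynomial ℤ) (i : ι) :
    MvPolynomial.pderiv i (Polynomial.aeval (linP a) P) =
      MvPolynomial.C (a i) * Polynomial.aeval (linP a) (Polynomial.derivative P) := by
  have h := Derivation.map_aeval ((MvPolynomial.pderiv (R := ℝ) i).restrictScalars ℤ) P (linP a)
  have h2 : MvPolynomial.pderiv i (linP a) = MvPolynomial.C (a i) := by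
    simp only [linP, map_sum, MvPolynomial.pderiv_C_mul, MvPolynomial.pderiv_X]
    rw [Finset.sum_eq_single i]
    · simp
    · intro b _ hb; simp [hb]
    · simp
  simp only [Derivation.restrictScalars_apply] at h
  rw [h, h2, smul_eq_mul, mul_comm]

/-- Gaussian covariance of Hermite polynomials. -/
lemma hermite_cov {ι : Type*} [Fintype ι] (a b : ι → ℝ) (ha : dotp a a = 1) (k : ℕ) :
    ∫ g, Polynomial.aeval (dotp a g) (Polynomial.hermite k) *
      Polynomial.aeval (dotp b g) (Polynomial.hermite k) ∂(stdG ι) = (k.factorial : ℝ) * dotp a b ^ k := by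
  classical
  induction k with
  | zero => simp
  | succ k ih =>
    set A : ℕ → MvPolynomial ι ℝ := fun k => Polynomial.aeval (linP a) (Polynomial.hermite k) with hA
    set B : ℕ → MvPolynomial ι ℝ := fun k => Polynomial.aeval (linP b) (Polynomial.hermite k) with hB
    set A' : MvPolynomial ι ℝ := Polynomial.aeval (linP a) (Polynomial.derivative (Polynomial.hermite k)) with hA'
    have hIntg : ∫ g, MvPolynomial.eval g (A k * B k) ∂(stdG ι) = (k.factorial : ℝ) * dotp a b ^ k := by
      rw [← ih]; simp only [map_mul, hA, hB, eval_herm]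
    have e1 : ∀ g : ι → ℝ, Polynomial.aeval (dotp a g) (Polynomial.hermite (k + 1)) *
      Polynomial.aeval (dotp b g) (Polynomial.hermite (k + 1)) =
      ∑ i, a i * (g i * MvPolynomial.eval g (A k * B (k + 1))) - MvPolynomial.eval g (A' * B (k + 1)) := by
      intro g
      have : ∑ i, a i * (g i * MvPolynomial.eval g (A k * B (k + 1))) =
        dotp a g * MvPolynomial.eval g (A k * B (k + 1)) := by
        rw [dotp, Finset.sum_mul]; exact Finset.sum_congr rfl fun i _ => by ring
      rw [this]
      nth_rewrite 1 [Polynomial.hermite_succ]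
      simp only [map_mul, map_sub, hA, hB, hA', eval_herm, Polynomial.aeval_X]
      ring
    simp only [e1]
    have hI : ∀ i, Integrable (fun g : ι → ℝ => a i * (g i * MvPolynomial.eval g (A k * B (k + 1)))) (stdG ι) := by
      intro i
      refine Integrable.const_mul ?_ _
      exact mv_integrable_X _ i
    rw [integral_sub (integrable_finsetSum _ fun i _ => hI i) (mv_integrable _),
      integral_finsetSum _ fun i _ => hI i]
    have e2 : ∀ i, ∫ g : ι → ℝ, a i * (g i * MvPolynomial.eval g (A k * B (k + 1))) ∂(stdG ι) =
        a i * a i * (∫ g, MvPolynomial.eval g (A' * B (k + 1)) ∂(stdG ι)) +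
        a i * b i * ((k + 1 : ℕ) * ((k.factorial : ℝ) * dotp a b ^ k)) := by
      intro i
      rw [integral_const_mul, mv_stein, ← hIntg]
      have e3 : MvPolynomial.pderiv i (A k * B (k + 1)) =
          MvPolynomial.C (a i) * (A' * B (k + 1)) + MvPolynomial.C (b i * (k + 1 : ℕ)) * (A k * B k) := by
        rw [MvPolynomial.pderiv_mul]
        simp only [hA, hB, hA', pderiv_herm, derivative_hermite_succ]
        simp only [map_mul, map_natCast]; ring
      rw [e3]
      simp only [MvPolynomial.eval_add, MvPolynomial.eval_mul (p := MvPolynomial.C _), MvPolynomial.eval_C]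
      rw [integral_add ((mv_integrable _).const_mul _) ((mv_integrable _).const_mul _),
        integral_const_mul, integral_const_mul]
      ring
    simp only [e2]
    rw [Finset.sum_add_distrib, ← Finset.sum_mul, ← Finset.sum_mul]
    change dotp a a * _ + dotp a b * _ - _ = _
    rw [ha, Nat.factorial_succ]
    push_cast; ring


/-- the quadratic form of the `k`-th Hadamard power of the Gram matrix -/
def gramQ {ι κ : Type*} [Fintype ι] [Fintype κ] (w : κ → ι → ℝ) (k : ℕ) (v : κ → ℝ) : ℝ :=
  ∑ i, ∑ l, v i * v l * dotp (w i) (w l) ^ k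

lemma gramQ_succ {ι κ : Type*} [Fintype ι] [Fintype κ] (w : κ → ι → ℝ) (k : ℕ) (v : κ → ℝ) :
    gramQ w (k + 1) v = ∑ c, gramQ w k (fun i => v i * w i c) := by
  simp only [gramQ]
  rw [Finset.sum_comm]
  rw [Finset.sum_comm (s := (Finset.univ : Finset ι))]
  rw [Finset.sum_comm]
  refine Finset.sum_congr rfl fun i _ => ?_
  rw [Finset.sum_comm (s := (Finset.univ : Finset ι))]
  refine Finset.sum_congr rfl fun l _ => ?_
  rw [pow_succ]
  nth_rewrite 2 [dotp]
  rw [← mul_assoc, Finset.mul_sum]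
  refine Finset.sum_congr rfl fun c _ => ?_
  ring

lemma gramQ_zero {ι κ : Type*} [Fintype ι] [Fintype κ] (w : κ → ι → ℝ) (v : κ → ℝ) :
    gramQ w 0 v = (∑ i, v i) ^ 2 := by
  simp only [gramQ, pow_zero, mul_one, sq, Finset.sum_mul_sum]

lemma gramQ_nonneg {ι κ : Type*} [Fintype ι] [Fintype κ] (w : κ → ι → ℝ) (k : ℕ) (v : κ → ℝ) :
    0 ≤ gramQ w k v := by
  induction k generalizing v with
  | zero => rw [gramQ_zero]; positivity
  | succ k ih => rw [gramQ_succ]; exact Finset.sum_nonneg fun c _ => ih _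

lemma unit_sum {ι : Type*} [Fintype ι] (w : ι → ℝ) (h : dotp w w = 1) : ∑ c, w c ^ 2 = 1 := by
  rw [← h, dotp]; simp only [sq]

lemma gramQ_mono {ι κ : Type*} [Fintype ι] [Fintype κ] (w : κ → ι → ℝ)
    (hw : ∀ i, dotp (w i) (w i) = 1) (T : ℝ) (k : ℕ)
    (h : ∀ v, gramQ w k v ≤ T * ∑ i, v i ^ 2) (j : ℕ) (v : κ → ℝ) :
    gramQ w (k + j) v ≤ T * ∑ i, v i ^ 2 := by
  induction j generalizing v with
  | zero => exact h v
  | succ j ih =>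
    rw [← add_assoc, gramQ_succ]
    calc _ ≤ ∑ c, T * ∑ i, (v i * w i c) ^ 2 := Finset.sum_le_sum fun c _ => ih _
      _ = T * ∑ i, v i ^ 2 := by
        rw [← Finset.mul_sum, Finset.sum_comm]
        congr 1
        refine Finset.sum_congr rfl fun i _ => ?_
        simp only [mul_pow]
        rw [← Finset.mul_sum, unit_sum _ (hw i), mul_one]

lemma gramQ_one_le {ι κ : Type*} [Fintype ι] [Fintype κ] (w : κ → ι → ℝ)
    (hw : ∀ i, dotp (w i) (w i) = 1) (v : κ → ℝ) :
    gramQ w 1 v ≤ Fintype.card ι * gramQ w 3 v := by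
  have h3 : gramQ w 3 v = ∑ a, ∑ b, gramQ w 1 (fun i => v i * w i a * w i b) := by
    rw [gramQ_succ]
    simp only [gramQ_succ w 1]
  have h1 : ∀ u, gramQ w 1 u = ∑ c, (∑ i, u i * w i c) ^ 2 := by
    intro u; rw [gramQ_succ]; simp only [gramQ_zero]
  have hd : ∑ a, gramQ w 1 (fun i => v i * w i a * w i a) ≤ gramQ w 3 v := by
    rw [h3]
    refine Finset.sum_le_sum fun a _ => ?_
    exact Finset.single_le_sum (f := fun b => gramQ w 1 (fun i => v i * w i a * w i b))
      (fun b _ => gramQ_nonneg _ _ _) (Finset.mem_univ a)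
  refine le_trans ?_ (mul_le_mul_of_nonneg_left hd (Nat.cast_nonneg _))
  simp only [h1]
  rw [Finset.sum_comm, Finset.mul_sum]
  refine Finset.sum_le_sum fun c _ => ?_
  have e : ∑ i, v i * w i c = ∑ a, ∑ i, v i * w i a * w i a * w i c := by
    rw [Finset.sum_comm]
    refine Finset.sum_congr rfl fun i _ => ?_
    rw [← Finset.sum_mul]
    congr 1
    have := unit_sum _ (hw i)
    calc v i = v i * ∑ c, w i c ^ 2 := by rw [this, mul_one]
      _ = _ := by rw [Finset.mul_sum]; exact Finset.sum_congr rfl fun _ _ => by ring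
  rw [e]
  exact sq_sum_le_card_mul_sum_sq

/-- MvPolynomial for a hermite combination -/
def hermP {ι κ : Type*} [Fintype ι] [Fintype κ] (w : κ → ι → ℝ) (v : κ → ℝ) (k : ℕ) : MvPolynomial ι ℝ :=
  ∑ i, MvPolynomial.C (v i) * Polynomial.aeval (linP (w i)) (Polynomial.hermite k)

lemma eval_hermP {ι κ : Type*} [Fintype ι] [Fintype κ] (w : κ → ι → ℝ) (v : κ → ℝ) (k : ℕ) (g : ι → ℝ) :
    MvPolynomial.eval g (hermP w v k) =
      ∑ i, v i * Polynomial.aeval (dotp (w i) g) (Polynomial.hermite k) := by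
  simp only [hermP, map_sum, map_mul, MvPolynomial.eval_C, eval_herm]

lemma integral_hermP_sq {ι κ : Type*} [Fintype ι] [Fintype κ] (w : κ → ι → ℝ)
    (hw : ∀ i, dotp (w i) (w i) = 1) (v : κ → ℝ) (k : ℕ) :
    ∫ g, (∑ i, v i * Polynomial.aeval (dotp (w i) g) (Polynomial.hermite k)) ^ 2 ∂(stdG ι) =
      (k.factorial : ℝ) * gramQ w k v := by
  have hI : ∀ i l, Integrable (fun g : ι → ℝ => v i * v l *
      (Polynomial.aeval (dotp (w i) g) (Polynomial.hermite k) *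
      Polynomial.aeval (dotp (w l) g) (Polynomial.hermite k))) (stdG ι) := by
    intro i l
    refine Integrable.const_mul ?_ _
    refine (mv_integrable (Polynomial.aeval (linP (w i)) (Polynomial.hermite k) *
      Polynomial.aeval (linP (w l)) (Polynomial.hermite k))).congr
      (Filter.Eventually.of_forall fun g => ?_)
    simp only [map_mul, eval_herm]
  have e : ∀ g : ι → ℝ, (∑ i, v i * Polynomial.aeval (dotp (w i) g) (Polynomial.hermite k)) ^ 2 =
      ∑ i, ∑ l, v i * v l *
      (Polynomial.aeval (dotp (w i) g) (Polynomial.hermite k) *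
      Polynomial.aeval (dotp (w l) g) (Polynomial.hermite k)) := by
    intro g
    rw [sq, Finset.sum_mul_sum]
    exact Finset.sum_congr rfl fun i _ => Finset.sum_congr rfl fun l _ => by ring
  simp only [e]
  rw [integral_finsetSum _ fun i _ => integrable_finsetSum _ fun l _ => hI i l, gramQ, Finset.mul_sum]
  refine Finset.sum_congr rfl fun i _ => ?_
  rw [integral_finsetSum _ fun l _ => hI i l, Finset.mul_sum]
  refine Finset.sum_congr rfl fun l _ => ?_
  rw [integral_const_mul, hermite_cov _ _ (hw i)]
  ring

lemma integrable_hermP_sq {ι κ : Type*} [Fintype ι] [Fintype κ] (w : κ → ι → ℝ) (v : κ → ℝ) (k : ℕ) :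
    Integrable (fun g => (∑ i, v i * Polynomial.aeval (dotp (w i) g) (Polynomial.hermite k)) ^ 2)
      (stdG ι) := by
  refine (mv_integrable (hermP w v k ^ 2)).congr (Filter.Eventually.of_forall fun g => ?_)
  simp only [map_pow, eval_hermP]

lemma lintegral_He_sq {ι κ : Type*} [Fintype ι] [Fintype κ] (w : κ → ι → ℝ)
    (hw : ∀ i, dotp (w i) (w i) = 1) (v : κ → ℝ) (k : ℕ) :
    ∫⁻ g, ENNReal.ofReal ((∑ i, v i * He k (dotp (w i) g)) ^ 2) ∂(stdG ι) =
      ENNReal.ofReal (gramQ w k v) := by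
  have hf : (0:ℝ) < k.factorial := by positivity
  have e : ∀ g : ι → ℝ, (∑ i, v i * He k (dotp (w i) g)) ^ 2 = (k.factorial : ℝ)⁻¹ *
      (∑ i, v i * Polynomial.aeval (dotp (w i) g) (Polynomial.hermite k)) ^ 2 := by
    intro g
    have : ∑ i, v i * He k (dotp (w i) g) = (√(k.factorial : ℝ))⁻¹ *
      (∑ i, v i * Polynomial.aeval (dotp (w i) g) (Polynomial.hermite k)) := by
      rw [Finset.mul_sum]
      refine Finset.sum_congr rfl fun i _ => ?_
      rw [He]; ring
    rw [this, mul_pow, inv_pow, Real.sq_sqrt hf.le]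
  simp only [e]
  rw [← ofReal_integral_eq_lintegral_ofReal ((integrable_hermP_sq w v k).const_mul _)
    (Filter.Eventually.of_forall fun g => by positivity), integral_const_mul,
    integral_hermP_sq w hw]
  congr 1
  field_simp

lemma hermite_three (x : ℝ) : Polynomial.aeval x (Polynomial.hermite 3) = x ^ 3 - 3 * x := by
  rw [Polynomial.hermite_succ, Polynomial.hermite_succ, Polynomial.hermite_one]
  simp
  ring

lemma lintegral_cube_sq {ι κ : Type*} [Fintype ι] [Nonempty ι] [Fintype κ] (w : κ → ι → ℝ)
    (hw : ∀ i, dotp (w i) (w i) = 1) (v : κ → ℝ) :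
    ∫⁻ g, ENNReal.ofReal ((∑ i, v i * dotp (w i) g ^ 3) ^ 2) ∂(stdG ι) ≤
      ENNReal.ofReal (30 * Fintype.card ι * gramQ w 3 v) := by
  have i1 := integrable_hermP_sq w v 1
  have i3 := integrable_hermP_sq w v 3
  have hd : (1:ℝ) ≤ Fintype.card ι := by exact_mod_cast Fintype.card_pos
  calc _ ≤ ∫⁻ g, ENNReal.ofReal (2 * (∑ i, v i * Polynomial.aeval (dotp (w i) g) (Polynomial.hermite 3)) ^ 2
        + 18 * (∑ i, v i * Polynomial.aeval (dotp (w i) g) (Polynomial.hermite 1)) ^ 2) ∂(stdG ι) := by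
        refine lintegral_mono fun g => ENNReal.ofReal_le_ofReal ?_
        have : ∑ i, v i * dotp (w i) g ^ 3 =
          ∑ i, v i * Polynomial.aeval (dotp (w i) g) (Polynomial.hermite 3) +
          3 * ∑ i, v i * Polynomial.aeval (dotp (w i) g) (Polynomial.hermite 1) := by
          rw [Finset.mul_sum, ← Finset.sum_add_distrib]
          refine Finset.sum_congr rfl fun i _ => ?_
          rw [hermite_three, Polynomial.hermite_one, Polynomial.aeval_X]; ring
        rw [this]
        nlinarith [sq_nonneg (∑ i, v i * Polynomial.aeval (dotp (w i) g) (Polynomial.hermite 3) -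
          3 * ∑ i, v i * Polynomial.aeval (dotp (w i) g) (Polynomial.hermite 1))]
    _ = ENNReal.ofReal (12 * gramQ w 3 v + 18 * gramQ w 1 v) := by
        have i13 : Integrable (fun g => 2 * (∑ i, v i * Polynomial.aeval (dotp (w i) g) (Polynomial.hermite 3)) ^ 2
          + 18 * (∑ i, v i * Polynomial.aeval (dotp (w i) g) (Polynomial.hermite 1)) ^ 2) (stdG ι) :=
          (i3.const_mul 2).add (i1.const_mul 18)
        rw [← ofReal_integral_eq_lintegral_ofReal i13
          (Filter.Eventually.of_forall fun g => by positivity),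
          integral_add (i3.const_mul _) (i1.const_mul _), integral_const_mul, integral_const_mul,
          integral_hermP_sq w hw, integral_hermP_sq w hw]
        congr 1
        norm_num [Nat.factorial]
        ring
    _ ≤ _ := by
        refine ENNReal.ofReal_le_ofReal ?_
        have := gramQ_one_le w hw v
        have h0 := gramQ_nonneg w 3 v
        nlinarith


lemma meas_le_integral {Ω : Type*} [MeasurableSpace Ω] (μ : Measure Ω) (A : Set Ω) (hA : MeasurableSet A)
    (f : Ω → ℝ) (hf : Integrable f μ) (h0 : ∀ x, 0 ≤ f x) (h1 : ∀ x ∈ A, 1 ≤ f x) :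
    μ A ≤ ENNReal.ofReal (∫ x, f x ∂μ) := by
  rw [ofReal_integral_eq_lintegral_ofReal hf (Filter.Eventually.of_forall h0), ← lintegral_indicator_one hA]
  refine lintegral_mono fun x => ?_
  by_cases hx : x ∈ A
  · simp only [Set.indicator_of_mem hx, Pi.one_apply]
    rw [← ENNReal.ofReal_one]
    exact ENNReal.ofReal_le_ofReal (h1 x hx)
  · simp [Set.indicator_of_notMem hx]

lemma integrable_exp_gauss (c : ℝ) : Integrable (fun x : ℝ => Real.exp (c * x)) (gaussianReal 0 1) :=
  integrable_exp_mul_gaussianReal c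

lemma integral_exp_gauss (c : ℝ) : ∫ x : ℝ, Real.exp (c * x) ∂(gaussianReal 0 1) = Real.exp (c ^ 2 / 2) := by
  have := mgf_gaussianReal (p := gaussianReal 0 1) (X := id) (μ := 0) (v := 1) (by simp) c
  simpa [mgf] using this

lemma measurable_dotp {ι : Type*} [Fintype ι] (w : ι → ℝ) : Measurable (fun x : ι → ℝ => dotp w x) := by
  unfold dotp; fun_prop

lemma tail_one {ι : Type*} [Fintype ι] (w : ι → ℝ) (hw : dotp w w = 1) (t : ℝ) :
    stdG ι {x | t < dotp w x} ≤ ENNReal.ofReal (2 * Real.exp (-t)) := by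
  have hprod : ∀ x : ι → ℝ, Real.exp (dotp w x - t) = Real.exp (-t) * ∏ i, Real.exp (w i * x i) := by
    intro x
    rw [← Real.exp_sum, ← Real.exp_add, dotp]; congr 1; ring
  have hIntg : Integrable (fun x : ι → ℝ => Real.exp (-t) * ∏ i, Real.exp (w i * x i)) (stdG ι) := by
    refine Integrable.const_mul ?_ _
    exact Integrable.fintype_prod (f := fun i (x : ℝ) => Real.exp (w i * x)) (fun i => integrable_exp_gauss _)
  refine (meas_le_integral _ _ (measurableSet_lt measurable_const (measurable_dotp w)) _ hIntg
    (fun x => by positivity) (fun x hx => ?_)).trans ?_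
  · rw [← hprod]
    have : t < dotp w x := hx
    exact Real.one_le_exp (by linarith)
  · refine ENNReal.ofReal_le_ofReal ?_
    rw [integral_const_mul, stdG, integral_fintype_prod_eq_prod (fun i (x : ℝ) => Real.exp (w i * x))]
    simp only [integral_exp_gauss]
    rw [← Real.exp_sum, ← Finset.sum_div, unit_sum w hw, mul_comm]
    refine mul_le_mul_of_nonneg_right ?_ (Real.exp_pos _).le
    have h := Real.exp_one_lt_d9
    have h2 : Real.exp (1/2) ^ 2 = Real.exp 1 := by rw [← Real.exp_nat_mul]; norm_num
    nlinarith [Real.exp_pos (1/2)]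

lemma tail_abs {ι : Type*} [Fintype ι] (w : ι → ℝ) (hw : dotp w w = 1) (t : ℝ) :
    stdG ι {x | t < |dotp w x|} ≤ ENNReal.ofReal (4 * Real.exp (-t)) := by
  have hw' : dotp (-w) (-w) = 1 := by rw [← hw]; simp [dotp]
  have : {x : ι → ℝ | t < |dotp w x|} ⊆ {x | t < dotp w x} ∪ {x | t < dotp (-w) x} := by
    intro x hx
    have hx : t < |dotp w x| := hx
    rcases lt_abs.1 hx with h | h
    · exact Or.inl h
    · right
      show t < dotp (-w) x
      have e : dotp (-w) x = - dotp w x := by simp [dotp]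
      rw [e]; exact h
  refine (measure_mono this).trans ((measure_union_le _ _).trans ?_)
  refine (add_le_add (tail_one w hw t) (tail_one _ hw' t)).trans ?_
  rw [← ENNReal.ofReal_add (by positivity) (by positivity)]
  exact ENNReal.ofReal_le_ofReal (by linarith)

lemma exp_neg_sq_gauss : ∫ x : ℝ, Real.exp (-x ^ 2) ∂(gaussianReal 0 1) = 1 / √3 := by
  rw [integral_gaussianReal_eq_integral_smul one_ne_zero]
  have e : ∀ x : ℝ, gaussianPDFReal 0 1 x • Real.exp (-x ^ 2) =
      (√(2 * Real.pi))⁻¹ * Real.exp (-(3/2) * x ^ 2) := by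
    intro x
    simp only [gaussianPDFReal, smul_eq_mul, NNReal.coe_one, sub_zero, mul_one]
    rw [mul_assoc, ← Real.exp_add]
    congr 2; ring
  simp only [e]
  rw [integral_const_mul, integral_gaussian, ← Real.sqrt_inv, ← Real.sqrt_mul (by positivity),
    one_div, ← Real.sqrt_inv]
  congr 1
  have := Real.pi_pos
  field_simp

lemma small_norm {ι : Type*} [Fintype ι] :
    stdG ι {x | ∑ i, x i ^ 2 < (Fintype.card ι : ℝ) / 4} ≤ ENNReal.ofReal ((3/4) ^ Fintype.card ι) := by
  have hi1 : Integrable (fun x : ℝ => Real.exp (1/4 - x ^ 2)) (gaussianReal 0 1) := by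
    refine Integrable.of_bound (by fun_prop) (Real.exp (1/4)) (Filter.Eventually.of_forall fun x => ?_)
    rw [Real.norm_eq_abs, abs_of_pos (Real.exp_pos _)]
    exact Real.exp_le_exp.2 (by nlinarith)
  have hprod : ∀ x : ι → ℝ, Real.exp ((Fintype.card ι : ℝ) / 4 - ∑ i, x i ^ 2) =
      ∏ i, Real.exp (1/4 - x i ^ 2) := by
    intro x
    rw [← Real.exp_sum, Finset.sum_sub_distrib]
    congr 2
    simp; ring
  have hIntg : Integrable (fun x : ι → ℝ => ∏ i, Real.exp (1/4 - x i ^ 2)) (stdG ι) :=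
    Integrable.fintype_prod (f := fun i (x : ℝ) => Real.exp (1/4 - x ^ 2)) (fun i => hi1)
  refine (meas_le_integral _ _ (measurableSet_lt (by fun_prop) measurable_const) _ hIntg
    (fun x => by positivity) (fun x hx => ?_)).trans ?_
  · rw [← hprod]
    have : ∑ i, x i ^ 2 < (Fintype.card ι : ℝ) / 4 := hx
    exact Real.one_le_exp (by linarith)
  · refine ENNReal.ofReal_le_ofReal ?_
    rw [stdG, integral_fintype_prod_eq_prod (fun i (x : ℝ) => Real.exp (1/4 - x ^ 2))]
    rw [Finset.prod_const, Finset.card_univ]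
    refine pow_le_pow_left₀ (integral_nonneg fun x => (Real.exp_pos _).le) ?_ _
    have e : ∀ x : ℝ, Real.exp (1/4 - x ^ 2) = Real.exp (1/4) * Real.exp (-x ^ 2) := by
      intro x; rw [← Real.exp_add]; congr 1
    simp only [e]
    rw [integral_const_mul, exp_neg_sq_gauss]
    have h := Real.exp_one_lt_d9
    have h2 : Real.exp (1/4) ^ 4 = Real.exp 1 := by rw [← Real.exp_nat_mul]; norm_num
    have h3 : Real.exp (1/4) ≤ 1.285 := by
      by_contra hh
      push Not at hh
      have : (1.285:ℝ)^4 ≤ Real.exp (1/4) ^ 4 := pow_le_pow_left₀ (by norm_num) hh.le 4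
      rw [h2] at this
      norm_num at this h
      linarith
    have h4 : (1.72:ℝ) ≤ √3 := Real.le_sqrt_of_sq_le (by norm_num)
    have h5 : 0 < √3 := by positivity
    rw [mul_one_div, div_le_iff₀ h5]
    nlinarith

lemma zero_norm {ι : Type*} [Fintype ι] [Nonempty ι] : ∀ᵐ x ∂(stdG ι), 0 < ∑ i, x i ^ 2 := by
  have h : stdG ι {0} = 0 := by
    have : NullSingletonClass (gaussianReal 0 1) := noAtoms_gaussianReal one_ne_zero
    have := Measure.pi_nullSingletonClass (μ := fun _ : ι => gaussianReal 0 1) (Classical.arbitrary ι)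
    rw [stdG]; exact measure_singleton _
  have : ∀ᵐ x ∂(stdG ι), x ∉ ({0} : Set (ι → ℝ)) := measure_eq_zero_iff_ae_notMem.1 h
  filter_upwards [this] with x hx
  refine lt_of_le_of_ne (Finset.sum_nonneg fun i _ => sq_nonneg _) fun h0 => hx ?_
  have := (Finset.sum_eq_zero_iff_of_nonneg (fun i _ => sq_nonneg (x i))).1 h0.symm
  ext i
  simpa using this i (Finset.mem_univ i)

lemma measurable_sph {ι : Type*} [Fintype ι] : Measurable (fun x : ι → ℝ => (enorm2 x)⁻¹ • x) := by
  unfold enorm2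
  refine measurable_pi_lambda _ fun i => ?_
  simp only [Pi.smul_apply, smul_eq_mul]
  fun_prop

instance unifSphere_prob (ι : Type*) [Fintype ι] : IsProbabilityMeasure (unifSphere ι) :=
  Measure.isProbabilityMeasure_map measurable_sph.aemeasurable

lemma dotp_sph {ι : Type*} [Fintype ι] (x : ι → ℝ) (hx : 0 < ∑ i, x i ^ 2) :
    dotp ((enorm2 x)⁻¹ • x) ((enorm2 x)⁻¹ • x) = 1 := by
  have : dotp ((enorm2 x)⁻¹ • x) ((enorm2 x)⁻¹ • x) = ((enorm2 x) ^ 2)⁻¹ * ∑ i, x i ^ 2 := by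
    rw [dotp, Finset.mul_sum]
    refine Finset.sum_congr rfl fun i _ => ?_
    simp only [Pi.smul_apply, smul_eq_mul]; ring
  rw [this, enorm2, Real.sq_sqrt hx.le, inv_mul_cancel₀ hx.ne']

lemma measurable_dotp_self {ι : Type*} [Fintype ι] : Measurable (fun x : ι → ℝ => dotp x x) := by
  unfold dotp; fun_prop

lemma unit_ae {ι : Type*} [Fintype ι] [Nonempty ι] : unifSphere ι {w | dotp w w ≠ 1} = 0 := by
  have hm : MeasurableSet {w : ι → ℝ | dotp w w ≠ 1} :=
    (measurable_dotp_self (measurableSet_singleton (1:ℝ))).compl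
  rw [unifSphere, Measure.map_apply measurable_sph hm]
  have : ∀ᵐ x ∂(stdG ι), x ∉ (fun x : ι → ℝ => (enorm2 x)⁻¹ • x) ⁻¹' {w | dotp w w ≠ 1} := by
    filter_upwards [zero_norm] with x hx
    simp only [Set.mem_preimage, Set.mem_setOf_eq, not_not]
    exact dotp_sph x hx
  exact measure_eq_zero_iff_ae_notMem.2 this


/-- third tensor power -/
def tens {ι : Type*} (w : ι → ℝ) (q : ι × ι × ι) : ℝ := w q.1 * w q.2.1 * w q.2.2

open Classical in
/-- third tensor power, set to zero off the unit sphere -/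
def zt {ι : Type*} [Fintype ι] (w : ι → ℝ) (q : ι × ι × ι) : ℝ := if dotp w w = 1 then tens w q else 0

lemma tens_dot {ι : Type*} [Fintype ι] (a b : ι → ℝ) : tens a ⬝ᵥ tens b = dotp a b ^ 3 := by
  simp only [dotProduct, tens, Fintype.sum_prod_type, dotp]
  rw [pow_succ, sq, Finset.sum_mul_sum, Finset.sum_mul]
  refine Finset.sum_congr rfl fun i _ => ?_
  rw [Finset.sum_mul_sum]
  refine Finset.sum_congr rfl fun j _ => Finset.sum_congr rfl fun l _ => ?_
  ring

lemma zt_dot_le {ι : Type*} [Fintype ι] (w : ι → ℝ) : zt w ⬝ᵥ zt w ≤ 1 := by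
  by_cases h : dotp w w = 1
  · have : zt w = tens w := by ext q; simp [zt, h]
    rw [this, tens_dot, h]; norm_num
  · have : zt w = 0 := by ext q; simp [zt, h]
    rw [this]; simp

lemma measurable_zt {ι : Type*} [Fintype ι] (q : ι × ι × ι) : Measurable (fun w : ι → ℝ => zt w q) := by
  unfold zt
  refine Measurable.ite (measurable_dotp_self (measurableSet_singleton (1:ℝ))) ?_ measurable_const
  unfold tens; fun_prop

lemma cs_dot {ι : Type*} [Fintype ι] (a b : ι → ℝ) : (a ⬝ᵥ b) ^ 2 ≤ (a ⬝ᵥ a) * (b ⬝ᵥ b) := by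
  have := Finset.sum_mul_sq_le_sq_mul_sq Finset.univ a b
  simpa [dotProduct, sq] using this

lemma tens_smul {ι : Type*} (s : ℝ) (w : ι → ℝ) : tens (s • w) = s ^ 3 • tens w := by
  ext q; simp [tens]; ring

lemma cov_span {ι J : Type*} [Fintype ι] [Nonempty ι] [Fintype J] (u : J → ι → ℝ)
    (hu : ∀ j, dotp (u j) (u j) = 1) (v : J → ℝ) (T : ι × ι × ι → ℝ) (hT : T = ∑ j, v j • tens (u j)) :
    ∫⁻ w, ENNReal.ofReal ((T ⬝ᵥ zt w) ^ 2) ∂(unifSphere ι) ≤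
      ENNReal.ofReal ((1920 / (Fintype.card ι : ℝ) ^ 2 + (3/4) ^ Fintype.card ι) * (T ⬝ᵥ T)) := by
  set d : ℝ := (Fintype.card ι : ℝ) with hd
  have hd1 : 0 < d := by rw [hd]; exact_mod_cast Fintype.card_pos
  have hTg : ∀ g, T ⬝ᵥ tens g = ∑ j, v j * dotp (u j) g ^ 3 := by
    intro g
    rw [hT, sum_dotProduct]
    refine Finset.sum_congr rfl fun j _ => ?_
    rw [smul_dotProduct, tens_dot, smul_eq_mul]
  have hTT : T ⬝ᵥ T = gramQ u 3 v := by
    nth_rewrite 2 [hT]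
    rw [dotProduct_sum, gramQ]
    refine Finset.sum_congr rfl fun j _ => ?_
    rw [dotProduct_smul, hTg, smul_eq_mul, Finset.mul_sum]
    refine Finset.sum_congr rfl fun l _ => ?_
    rw [show dotp (u l) (u j) = dotp (u j) (u l) by simp only [dotp, mul_comm]]
    ring
  have hT0 : 0 ≤ T ⬝ᵥ T := by rw [hTT]; exact gramQ_nonneg _ _ _
  have hmz : Measurable (fun w : ι → ℝ => ENNReal.ofReal ((T ⬝ᵥ zt w) ^ 2)) := by
    refine ENNReal.measurable_ofReal.comp (Measurable.pow_const ?_ 2)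
    simp only [dotProduct]
    exact Finset.measurable_sum _ fun q _ => (measurable_zt q).const_mul _
  rw [unifSphere, lintegral_map hmz measurable_sph]
  set A : Set (ι → ℝ) := {x | ∑ i, x i ^ 2 < d / 4} with hA
  have hmA : MeasurableSet A := measurableSet_lt (by fun_prop) measurable_const
  calc _ ≤ ∫⁻ g, (ENNReal.ofReal (64 / d ^ 3) * ENNReal.ofReal ((∑ j, v j * dotp (u j) g ^ 3) ^ 2) +
        A.indicator (fun _ => ENNReal.ofReal (T ⬝ᵥ T)) g) ∂(stdG ι) := by
        refine lintegral_mono fun g => ?_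
        by_cases hg : g ∈ A
        · rw [Set.indicator_of_mem hg]
          refine le_trans ?_ le_add_self
          refine ENNReal.ofReal_le_ofReal ((cs_dot _ _).trans ?_)
          have := zt_dot_le ((enorm2 g)⁻¹ • g)
          nlinarith
        · refine le_trans ?_ le_self_add
          rw [← ENNReal.ofReal_mul (by positivity)]
          refine ENNReal.ofReal_le_ofReal ?_
          by_cases h : dotp ((enorm2 g)⁻¹ • g) ((enorm2 g)⁻¹ • g) = 1
          · have e : zt ((enorm2 g)⁻¹ • g) = tens ((enorm2 g)⁻¹ • g) := by ext q; simp [zt, h]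
            rw [e, tens_smul, dotProduct_smul, smul_eq_mul, mul_pow, hTg]
            refine mul_le_mul_of_nonneg_right ?_ (sq_nonneg _)
            have hge : d / 4 ≤ ∑ i, g i ^ 2 := not_lt.1 hg
            have e2 : ((enorm2 g)⁻¹ ^ 3) ^ 2 = ((∑ i, g i ^ 2)⁻¹) ^ 3 := by
              rw [← pow_mul, mul_comm 3 2, pow_mul, enorm2, inv_pow, Real.sq_sqrt (by positivity)]
            rw [e2]
            have e3 : 64 / d ^ 3 = ((d / 4)⁻¹) ^ 3 := by field_simp; norm_num
            rw [e3]
            have : 0 < d / 4 := by positivity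
            exact pow_le_pow_left₀ (by positivity) (inv_anti₀ this hge) 3
          · have e : zt ((enorm2 g)⁻¹ • g) = 0 := by ext q; simp [zt, h]
            rw [e, dotProduct_zero, zero_pow two_ne_zero]
            positivity
    _ ≤ ENNReal.ofReal (64 / d ^ 3) * ENNReal.ofReal (30 * d * gramQ u 3 v) +
        ENNReal.ofReal (T ⬝ᵥ T) * ENNReal.ofReal ((3/4) ^ Fintype.card ι) := by
        rw [lintegral_add_right _ (measurable_const.indicator hmA),
          lintegral_const_mul' _ _ ENNReal.ofReal_ne_top, lintegral_indicator_const hmA]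
        gcongr
        · exact lintegral_cube_sq u hu v
        · exact small_norm
    _ = _ := by
        rw [← ENNReal.ofReal_mul (by positivity), ← ENNReal.ofReal_mul hT0,
          ← ENNReal.ofReal_add _ (by positivity), hTT]
        · congr 1
          field_simp
          ring
        · have := gramQ_nonneg u 3 v
          positivity

lemma exists_proj {ι : Type*} [Fintype ι] (T : ι × ι × ι → ℝ) :
    ∃ (J : Type) (_ : Fintype J) (u : J → ι → ℝ) (v : J → ℝ),
      (∀ j, dotp (u j) (u j) = 1) ∧ (∀ w, T ⬝ᵥ zt w = (∑ j, v j • tens (u j)) ⬝ᵥ zt w) ∧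
      (∑ j, v j • tens (u j)) ⬝ᵥ (∑ j, v j • tens (u j)) ≤ T ⬝ᵥ T := by
  let E := EuclideanSpace ℝ (ι × ι × ι)
  let f : {w : ι → ℝ // dotp w w = 1} → E := fun w => WithLp.toLp 2 (tens w.1)
  let U : Submodule ℝ E := Submodule.span ℝ (Set.range f)
  let x : E := WithLp.toLp 2 T
  let y : E := U.starProjection x
  have hy : y ∈ U := Submodule.starProjection_apply_mem U x
  have hin : ∀ a b : E, inner ℝ a b = a.ofLp ⬝ᵥ b.ofLp := by
    intro a b
    rw [PiLp.inner_apply]; simp [dotProduct, mul_comm]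
  have hperp : ∀ w : {w : ι → ℝ // dotp w w = 1}, inner ℝ x (f w) = inner ℝ y (f w) := by
    intro w
    have h1 : f w ∈ U := Submodule.subset_span ⟨w, rfl⟩
    have h2 := Submodule.sub_starProjection_mem_orthogonal (K := U) x
    have h3 := (Submodule.mem_orthogonal' U _).1 h2 (f w) h1
    rw [inner_sub_left] at h3
    linarith
  have hnorm : inner ℝ y y ≤ inner ℝ x x := by
    rw [real_inner_self_eq_norm_sq, real_inner_self_eq_norm_sq]
    exact pow_le_pow_left₀ (norm_nonneg _) (U.norm_starProjection_apply_le x) 2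
  obtain ⟨n, c, g, hyg⟩ := Submodule.mem_span_set'.1 hy
  choose ww hww using fun i => (g i).2
  have hy2 : y.ofLp = ∑ j, c j • tens (ww j).1 := by
    rw [← hyg, WithLp.ofLp_sum]
    refine Finset.sum_congr rfl fun j _ => ?_
    rw [← hww j]; rfl
  refine ⟨Fin n, inferInstance, fun j => (ww j).1, c, fun j => (ww j).2, ?_, ?_⟩
  · intro w
    rw [← hy2]
    by_cases h : dotp w w = 1
    · have e : zt w = tens w := by ext q; simp [zt, h]
      have := hperp ⟨w, h⟩
      rw [hin, hin] at this
      rw [e]; exact this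
    · have e : zt w = 0 := by ext q; simp [zt, h]
      rw [e]; simp
  · rw [← hy2]
    rw [hin, hin] at hnorm
    exact hnorm

lemma cov_zt {ι : Type*} [Fintype ι] [Nonempty ι] (T : ι × ι × ι → ℝ) :
    ∫⁻ w, ENNReal.ofReal ((T ⬝ᵥ zt w) ^ 2) ∂(unifSphere ι) ≤
      ENNReal.ofReal ((1920 / (Fintype.card ι : ℝ) ^ 2 + (3/4) ^ Fintype.card ι) * (T ⬝ᵥ T)) := by
  obtain ⟨J, hJ, u, v, hu, h1, h2⟩ := exists_proj T
  simp only [h1]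
  refine (cov_span u hu v _ rfl).trans (ENNReal.ofReal_le_ofReal ?_)
  exact mul_le_mul_of_nonneg_left h2 (by positivity)


lemma He_bound (k : ℕ) : ∃ B : ℝ, 1 ≤ B ∧ ∀ t x : ℝ, 1 ≤ t → |x| ≤ t → He k x ^ 2 ≤ B * t ^ (2 * k) := by
  set S : ℝ := ∑ i ∈ Finset.range (k + 1), |((Polynomial.hermite k).coeff i : ℝ)| with hS
  have hS0 : 0 ≤ S := Finset.sum_nonneg fun i _ => abs_nonneg _
  refine ⟨S ^ 2 + 1, by nlinarith, fun t x ht hx => ?_⟩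
  have h1 : |Polynomial.aeval x (Polynomial.hermite k)| ≤ S * t ^ k := by
    rw [Polynomial.aeval_eq_sum_range, Polynomial.natDegree_hermite, hS, Finset.sum_mul]
    refine (Finset.abs_sum_le_sum_abs _ _).trans (Finset.sum_le_sum fun i hi => ?_)
    rw [zsmul_eq_mul, abs_mul, abs_pow]
    refine mul_le_mul_of_nonneg_left ?_ (abs_nonneg _)
    calc |x| ^ i ≤ t ^ i := pow_le_pow_left₀ (abs_nonneg _) hx i
      _ ≤ t ^ k := pow_le_pow_right₀ ht (by have := Finset.mem_range.1 hi; omega)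
  have hf : (1:ℝ) ≤ k.factorial := by exact_mod_cast Nat.factorial_pos k
  rw [He, div_pow, Real.sq_sqrt (by linarith)]
  have h2 : (Polynomial.aeval x (Polynomial.hermite k)) ^ 2 ≤ (S * t ^ k) ^ 2 := by
    rw [← sq_abs]; exact pow_le_pow_left₀ (abs_nonneg _) h1 2
  have h3 : (Polynomial.aeval x (Polynomial.hermite k)) ^ 2 / (k.factorial : ℝ) ≤
      (Polynomial.aeval x (Polynomial.hermite k)) ^ 2 := div_le_self (sq_nonneg _) hf
  have h4 : (S * t ^ k) ^ 2 = S ^ 2 * t ^ (2 * k) := by rw [mul_pow, ← pow_mul, mul_comm k 2]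
  have h5 : 0 ≤ t ^ (2 * k) := by positivity
  nlinarith

lemma ms_forall {Ω κ : Type*} [MeasurableSpace Ω] [Countable κ] {P : κ → Ω → Prop}
    (h : ∀ l, MeasurableSet {ω | P l ω}) : MeasurableSet {ω | ∀ l, P l ω} := by
  have e : {ω | ∀ l, P l ω} = ⋂ l, {ω | P l ω} := by ext ω; simp
  rw [e]; exact MeasurableSet.iInter h

lemma measurable_He (k : ℕ) : Measurable (He k) := by
  unfold He
  exact (Polynomial.continuous_aeval _).measurable.div_const _

lemma prod_le {α β : Type*} [MeasurableSpace α] [MeasurableSpace β] (μ : Measure α) (ν : Measure β)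
    [IsProbabilityMeasure μ] [IsProbabilityMeasure ν] (B : Set (α × β)) (hB : MeasurableSet B) (c : ENNReal)
    (h : ∀ w, ν (Prod.mk w ⁻¹' B) ≤ c) : (μ.prod ν) B ≤ c := by
  rw [Measure.prod_apply hB]
  calc _ ≤ ∫⁻ _, c ∂μ := lintegral_mono h
    _ = c := by simp

lemma gramQ_three {ι κ : Type*} [Fintype ι] [Fintype κ] (w : κ → ι → ℝ) (v : κ → ℝ) :
    ∑ q, (∑ j, v j * tens (w j) q) ^ 2 = gramQ w 3 v := by
  simp only [sq, Finset.sum_mul_sum]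
  rw [Finset.sum_comm, gramQ]
  refine Finset.sum_congr rfl fun i _ => ?_
  rw [Finset.sum_comm]
  refine Finset.sum_congr rfl fun l _ => ?_
  rw [← tens_dot, dotProduct, Finset.mul_sum]
  exact Finset.sum_congr rfl fun q _ => by ring

open Classical in
/-- truncated Hermite features -/
def zz {ι κ : Type*} [Fintype ι] (k : ℕ) (t : ℝ) (w : κ → ι → ℝ) (x : ι → ℝ) (i : κ) : ℝ :=
  if ∀ l, |dotp (w l) x| ≤ t then He k (dotp (w i) x) else 0

lemma measurable_dotp₂ {ι Ω : Type*} [Fintype ι] [MeasurableSpace Ω] (f g : Ω → ι → ℝ)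
    (hf : Measurable f) (hg : Measurable g) : Measurable fun ω => dotp (f ω) (g ω) := by
  unfold dotp
  exact Finset.measurable_sum _ fun i _ =>
    ((measurable_pi_apply i).comp hf).mul ((measurable_pi_apply i).comp hg)

lemma measurable_zz {ι κ Ω : Type*} [Fintype ι] [Fintype κ] [MeasurableSpace Ω] (k : ℕ) (t : ℝ)
    (f : Ω → κ → ι → ℝ) (g : Ω → ι → ℝ) (hf : Measurable f) (hg : Measurable g) (i : κ) :
    Measurable fun ω => zz k t (f ω) (g ω) i := by
  have h : ∀ l, Measurable fun ω => dotp (f ω l) (g ω) := fun l =>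
    measurable_dotp₂ (fun ω => f ω l) g ((measurable_pi_apply l).comp hf) hg
  unfold zz
  refine Measurable.ite ?_ ((measurable_He k).comp (h i)) measurable_const
  exact ms_forall fun l => measurableSet_le ((measurable_norm.comp (h l))) measurable_const

lemma zz_dot_le {ι κ : Type*} [Fintype ι] [Fintype κ] (k : ℕ) (t : ℝ) (R : ℝ) (hR : 0 ≤ R)
    (h : ∀ x, |x| ≤ t → He k x ^ 2 ≤ R) (w : κ → ι → ℝ) (x : ι → ℝ) :
    zz k t w x ⬝ᵥ zz k t w x ≤ Fintype.card κ * R := by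
  rw [dotProduct, ← Finset.card_univ, ← nsmul_eq_mul, ← Finset.sum_const]
  refine Finset.sum_le_sum fun i _ => ?_
  rw [← sq]
  by_cases hh : ∀ l, |dotp (w l) x| ≤ t
  · rw [zz, if_pos hh]; exact h _ (hh i)
  · rw [zz, if_neg hh]; simpa using hR

lemma zz_cov {ι κ : Type*} [Fintype ι] [Fintype κ] (k : ℕ) (t : ℝ) (w : κ → ι → ℝ) (σ : ℝ)
    (hw : ∀ i, dotp (w i) (w i) = 1)
    (h : ∀ v, gramQ w k v ≤ σ * ∑ i, v i ^ 2) (v : κ → ℝ) :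
    ∫⁻ x, ENNReal.ofReal ((v ⬝ᵥ zz k t w x) ^ 2) ∂(stdG ι) ≤ ENNReal.ofReal (σ * (v ⬝ᵥ v)) := by
  calc _ ≤ ∫⁻ g, ENNReal.ofReal ((∑ i, v i * He k (dotp (w i) g)) ^ 2) ∂(stdG ι) := by
        refine lintegral_mono fun g => ENNReal.ofReal_le_ofReal ?_
        by_cases hh : ∀ l, |dotp (w l) g| ≤ t
        · have : zz k t w g = fun i => He k (dotp (w i) g) := by ext i; rw [zz, if_pos hh]
          rw [this]; rfl
        · have : zz k t w g = 0 := by ext i; rw [zz, if_neg hh]; rfl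
          rw [this, dotProduct_zero, zero_pow two_ne_zero]; positivity
    _ = _ := lintegral_He_sq w hw v k
    _ ≤ _ := by
        refine ENNReal.ofReal_le_ofReal ((h v).trans (le_of_eq ?_))
        simp only [dotProduct, sq]

/-- good weights -/
def goodW (ι : Type*) [Fintype ι] [DecidableEq ι] (p m : ℕ) (T : ℝ) : Set (Fin p → ι → ℝ) :=
  {w | (∀ i, dotp (w i) (w i) = 1) ∧ (sumMat (fun j => zt (w j)) ^ m).trace ≤ T ^ m}

lemma measurable_goodW (ι : Type*) [Fintype ι] [DecidableEq ι] (p m : ℕ) (T : ℝ) :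
    MeasurableSet (goodW ι p m T) := by
  refine MeasurableSet.inter ?_ ?_
  · exact ms_forall fun i =>
      (measurable_dotp_self.comp (measurable_pi_apply i)) (measurableSet_singleton (1:ℝ))
  · exact measurableSet_le (measurable_trace_pow (fun (w : Fin p → ι → ℝ) (j : Fin p) => zt (w j))
      (fun j a => (measurable_zt a).comp (measurable_pi_apply j)) m) measurable_const

lemma goodW_gram {ι : Type*} [Fintype ι] [DecidableEq ι] {p m : ℕ} {T : ℝ} (hT : 0 ≤ T) (hm : m ≠ 0)
    {w : Fin p → ι → ℝ} (hw : w ∈ goodW ι p m T) {k : ℕ} (hk : 3 ≤ k) (v : Fin p → ℝ) :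
    gramQ w k v ≤ T * ∑ i, v i ^ 2 := by
  obtain ⟨j, rfl⟩ := Nat.exists_eq_add_of_le hk
  refine gramQ_mono w hw.1 T 3 (fun v => ?_) j v
  have := form_le_of_trace (fun j => zt (w j)) T hT m hm hw.2 v
  rw [← gramQ_three]
  refine le_trans (le_of_eq ?_) this
  refine Finset.sum_congr rfl fun q _ => ?_
  congr 1
  refine Finset.sum_congr rfl fun j _ => ?_
  congr 1
  rw [zt, if_pos (hw.1 j)]

lemma goodW_prob {ι : Type*} [Fintype ι] [DecidableEq ι] [Nonempty ι] (p m : ℕ) (L : ℝ)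
    (hL1 : Real.exp 1 * p * (1920 / (Fintype.card ι : ℝ) ^ 2 + (3/4) ^ Fintype.card ι) ≤ L)
    (hL2 : (m + 1 : ℝ) ≤ L) :
    (Measure.pi fun _ : Fin p => unifSphere ι) (goodW ι p m (Real.exp 1 * L))ᶜ ≤
      ENNReal.ofReal (((Fintype.card ι : ℝ) ^ 3 + m * p) * Real.exp (-m)) := by
  have hsub : (goodW ι p m (Real.exp 1 * L))ᶜ ⊆
      (⋃ i : Fin p, (fun w : Fin p → ι → ℝ => w i) ⁻¹' {w | dotp w w ≠ 1}) ∪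
      {w | (Real.exp 1 * L) ^ m < (sumMat (fun j => zt (w j)) ^ m).trace} := by
    intro w hw
    by_cases h : ∀ i, dotp (w i) (w i) = 1
    · right
      by_contra h2
      exact hw ⟨h, not_lt.1 h2⟩
    · left
      push Not at h
      obtain ⟨i, hi⟩ := h
      exact Set.mem_iUnion.2 ⟨i, hi⟩
  have hm : MeasurableSet {w : ι → ℝ | dotp w w ≠ 1} :=
    (measurable_dotp_self (measurableSet_singleton (1:ℝ))).compl
  have h0 : (Measure.pi fun _ : Fin p => unifSphere ι)
      (⋃ i : Fin p, (fun w : Fin p → ι → ℝ => w i) ⁻¹' {w | dotp w w ≠ 1}) = 0 := by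
    refine measure_iUnion_null fun i => ?_
    have := (measurePreserving_eval (fun _ : Fin p => unifSphere ι) i).measure_preimage hm.nullMeasurableSet
    rw [unit_ae] at this
    exact this
  have h1 := trace_tail (unifSphere ι) (fun w => zt w) (fun a => measurable_zt a)
    (1920 / (Fintype.card ι : ℝ) ^ 2 + (3/4) ^ Fintype.card ι) 1 (by positivity) one_pos cov_zt
    zt_dot_le m p L hL1 (by linarith)
  refine (measure_mono hsub).trans ((measure_union_le _ _).trans ?_)
  rw [h0, zero_add]
  refine h1.trans (le_of_eq ?_)
  simp only [Fintype.card_prod]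
  push_cast
  congr 3
  ring

lemma badX_prob {ι : Type*} [Fintype ι] (n p : ℕ) (t : ℝ) (w : Fin p → ι → ℝ)
    (hw : ∀ i, dotp (w i) (w i) = 1) :
    (Measure.pi fun _ : Fin n => stdG ι) {x | ∃ i j, t < |dotp (w i) (x j)|} ≤
      ENNReal.ofReal (4 * p * n * Real.exp (-t)) := by
  have e : {x : Fin n → ι → ℝ | ∃ i j, t < |dotp (w i) (x j)|} =
      ⋃ i : Fin p, ⋃ j : Fin n, (fun x : Fin n → ι → ℝ => x j) ⁻¹' {x | t < |dotp (w i) x|} := by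
    ext x; simp
  rw [e]
  refine (measure_iUnion_fintype_le _ _).trans ?_
  calc _ ≤ ∑ i : Fin p, ∑ j : Fin n, ENNReal.ofReal (4 * Real.exp (-t)) := by
        refine Finset.sum_le_sum fun i _ => (measure_iUnion_fintype_le _ _).trans ?_
        refine Finset.sum_le_sum fun j _ => ?_
        have hm : MeasurableSet {x : ι → ℝ | t < |dotp (w i) x|} :=
          measurableSet_lt measurable_const (measurable_norm.comp (measurable_dotp (w i)))
        have := (measurePreserving_eval (fun _ : Fin n => stdG ι) j).measure_preimage hm.nullMeasurableSet
        exact this.le.trans (tail_abs (w i) (hw i) t)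
    _ = _ := by
        simp only [Finset.sum_const, Finset.card_univ, Fintype.card_fin, nsmul_eq_mul]
        rw [← ENNReal.ofReal_natCast, ← ENNReal.ofReal_natCast, ← ENNReal.ofReal_mul (by positivity),
          ← ENNReal.ofReal_mul (by positivity)]
        congr 1; ring

lemma opNorm_le {ι κ : Type*} [Fintype ι] [Fintype κ] (A : ι → κ → ℝ) (T : ℝ) (hT : 0 ≤ T)
    (h : ∀ a : κ → ℝ, ∑ i, (∑ j, a j * A i j) ^ 2 ≤ T * ∑ j, a j ^ 2) : opNorm A ≤ √T := by
  unfold opNorm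
  refine Real.iSup_le (fun v => ?_) (Real.sqrt_nonneg _)
  refine Real.sqrt_le_sqrt ?_
  have := h v.1
  simp only [mul_comm (v.1 _)] at this
  refine this.trans ?_
  have := v.2
  nlinarith


lemma core {ι : Type*} [Fintype ι] [DecidableEq ι] [Nonempty ι] (k : ℕ) (hk : 3 ≤ k) (n p m : ℕ)
    (hp : 1 ≤ p) (hm : m ≠ 0) (R L1 L2 : ℝ) (hR : 0 < R)
    (hHe : ∀ x : ℝ, |x| ≤ m → He k x ^ 2 ≤ R)
    (h1 : Real.exp 1 * p * (1920 / (Fintype.card ι : ℝ) ^ 2 + (3/4) ^ Fintype.card ι) ≤ L1)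
    (h2 : (m + 1 : ℝ) ≤ L1)
    (h3 : Real.exp 1 * n * (Real.exp 1 * L1) ≤ L2)
    (h4 : (m + 1 : ℝ) * (p * R) ≤ L2) :
    1 - ENNReal.ofReal (((Fintype.card ι : ℝ) ^ 3 + m * p + 4 * p * n + (p + m * n)) * Real.exp (-m)) ≤
      ((Measure.pi fun _ : Fin p => unifSphere ι).prod (Measure.pi fun _ : Fin n => stdG ι))
        {ω | opNorm (fun (i : Fin p) (j : Fin n) => He k (dotp (ω.1 i) (ω.2 j))) ≤
          √(Real.exp 1 * L2)} := by
  have hp0 : (0:ℝ) < p := by exact_mod_cast hp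
  have hm0 : (0:ℝ) ≤ m := Nat.cast_nonneg m
  have hL1 : 0 ≤ L1 := by linarith
  have hL2 : 0 ≤ L2 := le_trans (by positivity) h4
  set μ := (Measure.pi fun _ : Fin p => unifSphere ι) with hμ
  set ν := (Measure.pi fun _ : Fin n => stdG ι) with hν
  set G := goodW ι p m (Real.exp 1 * L1) with hG
  have hGm : MeasurableSet G := measurable_goodW _ _ _ _
  let S : Set ((Fin p → ι → ℝ) × (Fin n → ι → ℝ)) :=
    {ω | opNorm (fun (i : Fin p) (j : Fin n) => He k (dotp (ω.1 i) (ω.2 j))) ≤ √(Real.exp 1 * L2)}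
  let B1 : Set ((Fin p → ι → ℝ) × (Fin n → ι → ℝ)) := Prod.fst ⁻¹' Gᶜ
  let B2 : Set ((Fin p → ι → ℝ) × (Fin n → ι → ℝ)) :=
    Prod.fst ⁻¹' G ∩ {ω | ∃ i j, (m : ℝ) < |dotp (ω.1 i) (ω.2 j)|}
  let B3 : Set ((Fin p → ι → ℝ) × (Fin n → ι → ℝ)) :=
    Prod.fst ⁻¹' G ∩ {ω | (Real.exp 1 * L2) ^ m < (sumMat (fun j => zz k m ω.1 (ω.2 j)) ^ m).trace}
  have hcover : (Set.univ : Set ((Fin p → ι → ℝ) × (Fin n → ι → ℝ))) ⊆ S ∪ (B1 ∪ B2 ∪ B3) := by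
    rintro ⟨w, x⟩ -
    by_cases g : w ∈ G
    swap
    · exact Or.inr (Or.inl (Or.inl g))
    by_cases g2 : ∃ i j, (m : ℝ) < |dotp (w i) (x j)|
    · exact Or.inr (Or.inl (Or.inr ⟨g, g2⟩))
    by_cases g3 : (Real.exp 1 * L2) ^ m < (sumMat (fun j => zz k m w (x j)) ^ m).trace
    · exact Or.inr (Or.inr ⟨g, g3⟩)
    left
    push Not at g2
    refine opNorm_le _ _ (by positivity) fun a => ?_
    have := form_le_of_trace (fun j => zz k m w (x j)) (Real.exp 1 * L2) (by positivity) m hm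
      (not_lt.1 g3) a
    have e : ∀ j i, zz k m w (x j) i = He k (dotp (w i) (x j)) := by
      intro j i
      rw [zz, if_pos fun l => g2 l j]
    simp only [e] at this
    exact this
  have hB1 : (μ.prod ν) B1 ≤ ENNReal.ofReal (((Fintype.card ι : ℝ) ^ 3 + m * p) * Real.exp (-m)) := by
    have := (measurePreserving_fst (μ := μ) (ν := ν)).measure_preimage hGm.compl.nullMeasurableSet
    exact this.le.trans (goodW_prob p m L1 h1 h2)
  have hB2 : (μ.prod ν) B2 ≤ ENNReal.ofReal (4 * p * n * Real.exp (-m)) := by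
    refine prod_le μ ν B2 ?_ _ fun w => ?_
    · refine (measurable_fst hGm).inter ?_
      have e : {ω : (Fin p → ι → ℝ) × (Fin n → ι → ℝ) | ∃ i j, (m : ℝ) < |dotp (ω.1 i) (ω.2 j)|} =
        ⋃ i, ⋃ j, {ω | (m : ℝ) < |dotp (ω.1 i) (ω.2 j)|} := by ext ω; simp
      rw [e]
      refine MeasurableSet.iUnion fun i => MeasurableSet.iUnion fun j => ?_
      have hmd := measurable_dotp₂ (fun ω : (Fin p → ι → ℝ) × (Fin n → ι → ℝ) => ω.1 i) (fun ω => ω.2 j)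
        ((measurable_pi_apply i).comp measurable_fst) ((measurable_pi_apply j).comp measurable_snd)
      exact measurableSet_lt measurable_const (measurable_norm.comp hmd)
    · by_cases g : w ∈ G
      · refine le_trans (measure_mono ?_) (badX_prob n p m w g.1)
        intro x hx
        exact hx.2
      · have : Prod.mk w ⁻¹' B2 = ∅ := by
          ext x
          simp only [Set.mem_preimage, Set.mem_empty_iff_false, iff_false]
          exact fun h => g h.1
        rw [this]; simp
  have hB3 : (μ.prod ν) B3 ≤ ENNReal.ofReal ((p + m * n) * Real.exp (-m)) := by
    refine prod_le μ ν B3 ?_ _ fun w => ?_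
    · refine (measurable_fst hGm).inter ?_
      refine measurableSet_lt measurable_const ?_
      exact measurable_trace_pow
        (fun (ω : (Fin p → ι → ℝ) × (Fin n → ι → ℝ)) (j : Fin n) => zz k m ω.1 (ω.2 j))
        (fun j a => measurable_zz k m (fun ω : (Fin p → ι → ℝ) × (Fin n → ι → ℝ) => ω.1)
          (fun ω => ω.2 j) measurable_fst ((measurable_pi_apply j).comp measurable_snd) a) m
    · by_cases g : w ∈ G
      · have tt := trace_tail (stdG ι) (fun x => zz k m w x)
          (fun a => measurable_zz k m (fun _ => w) (fun x => x) measurable_const measurable_id a)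
          (Real.exp 1 * L1) (p * R) (by positivity) (by positivity)
          (fun v => zz_cov k m w _ g.1 (fun v => goodW_gram (by positivity) hm g hk v) v)
          (fun x => by simpa using zz_dot_le k m R hR.le hHe w x) m n L2 h3 h4
        rw [Fintype.card_fin] at tt
        refine le_trans (measure_mono ?_) tt
        intro x hx
        exact hx.2
      · have : Prod.mk w ⁻¹' B3 = ∅ := by
          ext x
          simp only [Set.mem_preimage, Set.mem_empty_iff_false, iff_false]
          exact fun h => g h.1
        rw [this]; simp
  rw [tsub_le_iff_right]
  calc (1 : ENNReal) = (μ.prod ν) Set.univ := by simp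
    _ ≤ (μ.prod ν) S + ((μ.prod ν) B1 + (μ.prod ν) B2 + (μ.prod ν) B3) :=
      (measure_mono hcover).trans ((measure_union_le _ _).trans (add_le_add le_rfl
        ((measure_union_le _ _).trans (add_le_add (measure_union_le _ _) le_rfl))))
    _ ≤ _ := by
      refine add_le_add le_rfl ((add_le_add (add_le_add hB1 hB2) hB3).trans (le_of_eq ?_))
      rw [← ENNReal.ofReal_add (by positivity) (by positivity),
        ← ENNReal.ofReal_add (by positivity) (by positivity)]
      congr 1; ring


lemma eventual_facts (Q D0 E : ℝ) : ∃ N : ℕ, ∀ d : ℕ, N ≤ d →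
    1 ≤ Real.log d ∧ Q ≤ Real.log d ∧ (d:ℝ) ^ 2 * (3/4) ^ d ≤ 80 ∧ (D0 + 6) * Real.log d ≤ d ∧ E ≤ (d:ℝ) := by
  have hlog : Filter.Tendsto (fun d : ℕ => Real.log d) Filter.atTop Filter.atTop :=
    Real.tendsto_log_atTop.comp tendsto_natCast_atTop_atTop
  have e1 := hlog.eventually_ge_atTop 1
  have e2 := hlog.eventually_ge_atTop Q
  have e3 : ∀ᶠ d : ℕ in Filter.atTop, (d:ℝ) ^ 2 * (3/4) ^ d ≤ 80 :=
    (tendsto_pow_const_mul_const_pow_of_abs_lt_one 2 (r := 3/4) (by rw [abs_of_pos] <;> norm_num)).eventually_le_const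
      (by norm_num)
  have e4 : ∀ᶠ d : ℕ in Filter.atTop, (D0 + 6) * Real.log d ≤ d := by
    have h := Real.isLittleO_log_id_atTop.bound (c := (|D0 + 6| + 1)⁻¹) (by positivity)
    have h' := tendsto_natCast_atTop_atTop (R := ℝ) |>.eventually h
    filter_upwards [h', e1] with d hd h1
    simp only [id, Real.norm_eq_abs, Nat.abs_cast] at hd
    rw [abs_of_nonneg (by linarith), inv_mul_eq_div, le_div_iff₀ (by positivity)] at hd
    have := le_abs_self (D0 + 6)
    nlinarith
  have e5 : ∀ᶠ d : ℕ in Filter.atTop, E ≤ (d:ℝ) := tendsto_natCast_atTop_atTop.eventually_ge_atTop E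
  have := e1.and (e2.and (e3.and (e4.and e5)))
  exact Filter.eventually_atTop.1 this


end Helpers

/-- **Lemma F.6**: operator norm of the `p × n` matrix `(He_k(⟨w_i, x_j⟩))_{ij}` of
degree-`k` Hermite random features, for `w_i` i.i.d. uniform on the sphere and
`x_j` i.i.d. standard Gaussians, with `n, p ≤ C₀ d²`. -/
theorem hermite_random_features_opNorm (k : ℕ) (hk : 3 ≤ k) (C0 D0 : ℝ)
    (hC0 : 0 < C0) (hD0 : 0 < D0) :
    ∃ C K : ℝ, 0 < C ∧ 0 < K ∧
      ∀ d n p : ℕ, C ≤ (d : ℝ) → 1 ≤ n → 1 ≤ p →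
        (n : ℝ) ≤ C0 * (d : ℝ) ^ 2 → (p : ℝ) ≤ C0 * (d : ℝ) ^ 2 →
        1 - ENNReal.ofReal ((d : ℝ) ^ (-D0)) ≤
          ((Measure.pi fun _ : Fin p => unifSphere (Fin d)).prod
              (Measure.pi fun _ : Fin n => stdG (Fin d)))
            {ω | opNorm (fun (i : Fin p) (j : Fin n) => He k (dotp (ω.1 i) (ω.2 j))) ≤
              Real.log d ^ K * (d : ℝ)} := by
  obtain ⟨B, hB1, hB⟩ := He_bound k
  set A1 : ℝ := 6000 * C0 + 2 with hA1
  set A2 : ℝ := 9 * C0 * A1 + 2 * C0 * B with hA2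
  have hA1p : 0 < A1 := by positivity
  have hA2p : 0 < A2 := by positivity
  obtain ⟨N, hN⟩ := eventual_facts (3 * A2 * (D0 + 6) ^ (2 * k + 2)) D0 (1 + 3 * C0 + 4 * C0 ^ 2)
  refine ⟨N + 1, ((k + 2 : ℕ) : ℝ), by positivity, by positivity, ?_⟩
  intro d n p hd hn hp hnC hpC
  have hd' : N + 1 ≤ d := by exact_mod_cast hd
  obtain ⟨f1, f2, f3, f4, f5⟩ := hN d (by omega)
  have hdpos : 0 < d := by omega
  have hd1 : (1:ℝ) ≤ d := by exact_mod_cast hdpos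
  have : Nonempty (Fin d) := ⟨⟨0, hdpos⟩⟩
  set l := Real.log d with hl
  set m : ℕ := ⌈(D0 + 5) * l⌉₊ with hm
  have hm_lo : (D0 + 5) * l ≤ m := Nat.le_ceil _
  have hm_pos : 0 < m := Nat.ceil_pos.2 (by positivity)
  have hm1 : (1:ℝ) ≤ m := by exact_mod_cast hm_pos
  have hm_hi : (m:ℝ) ≤ (D0 + 6) * l := by
    have := Nat.ceil_lt_add_one (a := (D0 + 5) * l) (by positivity)
    rw [← hm] at this
    nlinarith
  have he : Real.exp 1 ≤ 3 := by have := Real.exp_one_lt_d9; linarith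
  have he0 := Real.exp_pos 1
  have hp0 : (0:ℝ) ≤ p := Nat.cast_nonneg p
  have hn0 : (0:ℝ) ≤ n := Nat.cast_nonneg n
  have hmpow : (m:ℝ) ≤ (m:ℝ) ^ (2 * k + 1) := le_self_pow₀ hm1 (by omega)
  have key := core (ι := Fin d) k hk n p m hp hm_pos.ne' (B * (m:ℝ) ^ (2 * k)) (A1 * m)
    (A2 * (m:ℝ) ^ (2 * k + 1) * (d:ℝ) ^ 2) (by positivity) (fun x hx => hB m x hm1 hx)
    (by
      rw [Fintype.card_fin]
      have h1 : 1920 / (d:ℝ) ^ 2 + (3/4) ^ d ≤ 2000 / (d:ℝ) ^ 2 := by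
        rw [le_div_iff₀ (by positivity), add_mul, div_mul_cancel₀ _ (by positivity)]
        linarith
      calc Real.exp 1 * p * (1920 / (d:ℝ) ^ 2 + (3/4) ^ d)
          ≤ 3 * (C0 * (d:ℝ) ^ 2) * (2000 / (d:ℝ) ^ 2) := by gcongr
        _ = 6000 * C0 := by field_simp; norm_num
        _ ≤ A1 * m := by rw [hA1]; nlinarith)
    (by rw [hA1]; nlinarith)
    (by
      calc Real.exp 1 * n * (Real.exp 1 * (A1 * m)) ≤ 3 * (C0 * (d:ℝ) ^ 2) * (3 * (A1 * (m:ℝ) ^ (2 * k + 1))) := by gcongr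
        _ = (9 * C0 * A1) * (m:ℝ) ^ (2 * k + 1) * (d:ℝ) ^ 2 := by ring
        _ ≤ _ := by
          gcongr
          rw [hA2]
          have : 0 ≤ 2 * C0 * B := by positivity
          linarith)
    (by
      calc ((m:ℝ) + 1) * (p * (B * (m:ℝ) ^ (2 * k))) ≤ (m + m) * ((C0 * (d:ℝ) ^ 2) * (B * (m:ℝ) ^ (2 * k))) := by gcongr
        _ = (2 * C0 * B) * (m:ℝ) ^ (2 * k + 1) * (d:ℝ) ^ 2 := by ring
        _ ≤ _ := by
          gcongr
          rw [hA2]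
          have : 0 ≤ 9 * C0 * A1 := by positivity
          linarith)
  rw [Fintype.card_fin] at key
  refine le_trans (tsub_le_tsub_left (ENNReal.ofReal_le_ofReal ?_) 1) (key.trans (measure_mono ?_))
  · have hexp : Real.exp (-m) ≤ (d:ℝ) ^ (-D0) * ((d:ℝ) ^ 5)⁻¹ := by
      have e : (d:ℝ) ^ (-D0) * ((d:ℝ) ^ 5)⁻¹ = Real.exp (-((D0 + 5) * l)) := by
        rw [Real.rpow_def_of_pos (by linarith), ← hl]
        have : ((d:ℝ) ^ 5)⁻¹ = Real.exp (-(5 * l)) := by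
          rw [Real.exp_neg, hl, show (5:ℝ) = ((5:ℕ):ℝ) by norm_num, Real.exp_nat_mul,
            Real.exp_log (by linarith)]
        rw [this, ← Real.exp_add]; congr 1; ring
      rw [e]
      exact Real.exp_le_exp.2 (by linarith)
    have hmd : (m:ℝ) ≤ d := hm_hi.trans f4
    have hd23 : (d:ℝ) ^ 2 ≤ (d:ℝ) ^ 4 := pow_le_pow_right₀ hd1 (by norm_num)
    have hd34 : (d:ℝ) ^ 3 ≤ (d:ℝ) ^ 4 := pow_le_pow_right₀ hd1 (by norm_num)
    have hsum : (d:ℝ) ^ 3 + m * p + 4 * p * n + (p + m * n) ≤ (d:ℝ) ^ 5 := by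
      calc (d:ℝ) ^ 3 + m * p + 4 * p * n + (p + m * n)
          ≤ (d:ℝ) ^ 3 + d * (C0 * (d:ℝ) ^ 2) + 4 * (C0 * (d:ℝ) ^ 2) * (C0 * (d:ℝ) ^ 2) +
            (C0 * (d:ℝ) ^ 2 + d * (C0 * (d:ℝ) ^ 2)) := by gcongr
        _ = (d:ℝ) ^ 3 + 2 * C0 * (d:ℝ) ^ 3 + C0 * (d:ℝ) ^ 2 + 4 * C0 ^ 2 * (d:ℝ) ^ 4 := by ring
        _ ≤ (d:ℝ) ^ 4 + 2 * C0 * (d:ℝ) ^ 4 + C0 * (d:ℝ) ^ 4 + 4 * C0 ^ 2 * (d:ℝ) ^ 4 := by gcongr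
        _ = (1 + 3 * C0 + 4 * C0 ^ 2) * (d:ℝ) ^ 4 := by ring
        _ ≤ d * (d:ℝ) ^ 4 := by gcongr
        _ = (d:ℝ) ^ 5 := by ring
    calc _ ≤ (d:ℝ) ^ 5 * ((d:ℝ) ^ (-D0) * ((d:ℝ) ^ 5)⁻¹) := by gcongr
      _ = (d:ℝ) ^ (-D0) := by field_simp
  · intro ω hω
    refine le_trans (show opNorm _ ≤ _ from hω) ?_
    rw [Real.rpow_natCast]
    refine Real.sqrt_le_iff.2 ⟨by positivity, ?_⟩
    have hl0 : 0 ≤ l := by linarith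
    calc Real.exp 1 * (A2 * (m:ℝ) ^ (2 * k + 1) * (d:ℝ) ^ 2)
        ≤ 3 * (A2 * ((D0 + 6) * l) ^ (2 * k + 2) * (d:ℝ) ^ 2) := by
          gcongr
          calc (m:ℝ) ^ (2 * k + 1) ≤ (m:ℝ) ^ (2 * k + 2) := pow_le_pow_right₀ hm1 (by omega)
            _ ≤ _ := by gcongr
      _ = (3 * A2 * (D0 + 6) ^ (2 * k + 2)) * l ^ (2 * k + 2) * (d:ℝ) ^ 2 := by rw [mul_pow]; ring
      _ ≤ l ^ 2 * l ^ (2 * k + 2) * (d:ℝ) ^ 2 := by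
          gcongr
          nlinarith
      _ = (l ^ (k + 2) * d) ^ 2 := by ring
end
end

section
/- Uniform lower bound on the empirical misclassification error of affine classifiers (core of Lemma A.2). Let d, n ≥ 1 and p₀ ∈ (0, 1/2]. Let (x₁, y₁), …, (x_n, y_n) be i.i.d. random pairs with x_i ∈ ℝ^d and y_i ∈ {−1, +1}, and suppose that P[y₁ = −sgn(a + ⟨b, x₁⟩)] ≥ p₀ for every a ∈ ℝ and b ∈ ℝ^d, where sgn(u) := 1 if u ≥ 0 and sgn(u) := −1 if u < 0. Then there exist universal constants C, c > 0 such that whenever n ≥ C·d/p₀², with probability at least 1 − C·e^{−c·n·p₀²}: inf over all a ∈ ℝ, b ∈ ℝ^d of (1/n)·Σ_{i=1}^n 1{y_i = −sgn(a + ⟨b, x_i⟩)} ≥ p₀/4. -/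
/-!
Uniform lower bound on the empirical misclassification error of affine classifiers
(core of Lemma A.2).
-/

noncomputable section

open MeasureTheory

/-- `sgn u = 1` if `u ≥ 0` and `-1` otherwise. -/
def sgn (u : ℝ) : ℝ := if 0 ≤ u then 1 else -1

open Classical in
/-- Real-valued indicator of a proposition. -/
def ind (P : Prop) : ℝ := if P then 1 else 0


lemma ind_pos {P : Prop} (h : P) : ind P = 1 := by simp [ind, h]
lemma ind_neg {P : Prop} (h : ¬ P) : ind P = 0 := by simp [ind, h]
lemma ind_cases (P : Prop) : ind P = 0 ∨ ind P = 1 := by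
  by_cases h : P
  · exact Or.inr (ind_pos h)
  · exact Or.inl (ind_neg h)
lemma ind_nonneg (P : Prop) : 0 ≤ ind P := by
  rcases ind_cases P with h | h <;> simp [h]

/-- Swap coordinates according to `s`. -/
def swapFun {n : ℕ} (s : Fin n → Bool) : Fin n ⊕ Fin n → Fin n ⊕ Fin n
  | Sum.inl i => if s i then Sum.inr i else Sum.inl i
  | Sum.inr i => if s i then Sum.inl i else Sum.inr i

lemma swapFun_invol {n : ℕ} (s : Fin n → Bool) : Function.Involutive (swapFun s) := by
  rintro (i | i) <;> by_cases h : s i = true <;> simp [swapFun, h]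

def swapPerm {n : ℕ} (s : Fin n → Bool) : Equiv.Perm (Fin n ⊕ Fin n) :=
  (swapFun_invol s).toPerm

lemma measurePreserving_perm {ι Z : Type*} [Fintype ι] [MeasurableSpace Z] (μ : Measure Z)
    [SigmaFinite μ] (e : Equiv.Perm ι) :
    MeasurePreserving (fun X : ι → Z => fun i => X (e i)) (Measure.pi fun _ => μ)
      (Measure.pi fun _ => μ) where
  measurable := by fun_prop
  map_eq := by
    refine (Measure.pi_eq fun s hs => ?_).symm
    rw [Measure.map_apply (by fun_prop) (MeasurableSet.univ_pi hs)]
    have : (fun X : ι → Z => fun i => X (e i)) ⁻¹' (Set.univ.pi s)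
        = Set.univ.pi (fun i => s (e.symm i)) := by
      ext X
      simp only [Set.mem_preimage, Set.mem_univ_pi]
      constructor
      · intro h i
        simpa using h (e.symm i)
      · intro h i
        simpa using h (e i)
    rw [this, Measure.pi_pi]
    exact Equiv.prod_comp e.symm (fun i => μ (s i))

def gfac (u v : ℝ) (b : Bool) : ℝ :=
  Real.exp ((if b then u - v else v - u) / 3 - (u + v) / 18)

lemma gfac_sum (P Q : Prop) : ∑ b : Bool, gfac (ind P) (ind Q) b ≤ 2 := by
  have key : Real.exp (1/3 - 1/18) + Real.exp (-(1/3) - 1/18) ≤ 2 := by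
    have h := Real.cosh_le_exp_half_sq (1/3)
    rw [Real.cosh_eq] at h
    have h2 : Real.exp (1/3 - 1/18) + Real.exp (-(1/3) - 1/18)
        = (Real.exp (1/3) + Real.exp (-(1/3))) * Real.exp (-(1/18)) := by
      rw [add_mul, ← Real.exp_add, ← Real.exp_add]; ring_nf
    have h3 : Real.exp ((1/3:ℝ)^2/2) * Real.exp (-(1/18)) = 1 := by
      rw [← Real.exp_add]; norm_num
    rw [h2]
    nlinarith [Real.exp_pos (-(1/18:ℝ))]
  rw [Fintype.sum_bool]
  rcases ind_cases P with h | h <;> rcases ind_cases Q with h' | h' <;>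
    simp only [gfac, h, h', if_true] <;> norm_num at key ⊢ <;>
    linarith [show Real.exp (-(1/9)) ≤ 1 from Real.exp_le_one_iff.2 (by norm_num)]

open Classical in
def traces {κ Z ι : Type*} [Fintype ι] (A : κ → Set Z) (X : ι → Z) : Finset (Finset ι) :=
  Finset.univ.filter fun T => ∃ k, ∀ j, j ∈ T ↔ X j ∈ A k

def Dset {κ Z : Type*} (n : ℕ) (p0 : ℝ) (A : κ → Set Z) : Set (Fin n ⊕ Fin n → Z) :=
  {X | ∃ k, ∑ i, ind (X (Sum.inl i) ∈ A k) < n * p0 / 4 ∧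
    n * p0 / 2 ≤ ∑ i, ind (X (Sum.inr i) ∈ A k)}

lemma sum_prod_gfac {n : ℕ} (T : Finset (Fin n ⊕ Fin n)) :
    ∑ s : Fin n → Bool, ∏ i, gfac (ind (Sum.inl i ∈ T)) (ind (Sum.inr i ∈ T)) (s i) ≤ 2 ^ n := by
  have h := Finset.prod_univ_sum (fun _ : Fin n => (Finset.univ : Finset Bool))
    (fun i b => gfac (ind (Sum.inl i ∈ T)) (ind (Sum.inr i ∈ T)) b)
  rw [Fintype.piFinset_univ] at h
  rw [← h]
  calc _ ≤ ∏ _i : Fin n, (2:ℝ) := by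
        refine Finset.prod_le_prod (fun i _ => ?_) (fun i _ => gfac_sum _ _)
        exact Finset.sum_nonneg fun b _ => (Real.exp_pos _).le
    _ = _ := by simp

open Classical in
lemma pointwise_bound {κ Z : Type*} (n : ℕ) (p0 : ℝ) (hp : 0 < p0) (A : κ → Set Z)
    (X : Fin n ⊕ Fin n → Z) :
    ∑ s : Fin n → Bool, ind ((fun j => X (swapPerm s j)) ∈ Dset n p0 A) ≤
      2 ^ n * ((traces A X).card * Real.exp (-(n * p0 / 36))) := by
  have step : ∀ s : Fin n → Bool, ind ((fun j => X (swapPerm s j)) ∈ Dset n p0 A) ≤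
      ∑ T ∈ traces A X, (∏ i, gfac (ind (Sum.inl i ∈ T)) (ind (Sum.inr i ∈ T)) (s i))
        * Real.exp (-(n * p0 / 36)) := by
    intro s
    have hnn : ∀ T ∈ traces A X,
      0 ≤ (∏ i, gfac (ind (Sum.inl i ∈ T)) (ind (Sum.inr i ∈ T)) (s i))
        * Real.exp (-(n * p0 / 36)) := fun T _ =>
        mul_nonneg (Finset.prod_nonneg fun i _ => (Real.exp_pos _).le) (Real.exp_pos _).le
    by_cases hD : (fun j => X (swapPerm s j)) ∈ Dset n p0 A
    swap
    · rw [ind_neg hD]; exact Finset.sum_nonneg hnn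
    rw [ind_pos hD]
    obtain ⟨k, h1, h2⟩ := hD
    let T : Finset (Fin n ⊕ Fin n) := Finset.univ.filter fun j => X j ∈ A k
    have hT : T ∈ traces A X := by
      simp only [traces, Finset.mem_filter, Finset.mem_univ, true_and]
      exact ⟨k, fun j => by simp [T]⟩
    refine le_trans ?_ (Finset.single_le_sum hnn hT)
    have hmem : ∀ j, ind (j ∈ T) = ind (X j ∈ A k) := fun j => by simp [T]
    simp only [gfac, hmem]
    rw [← Real.exp_sum, ← Real.exp_add]
    apply Real.one_le_exp
    have e1 : ∀ i, (if s i then ind (X (Sum.inl i) ∈ A k) - ind (X (Sum.inr i) ∈ A k)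
          else ind (X (Sum.inr i) ∈ A k) - ind (X (Sum.inl i) ∈ A k)) / 3
          - (ind (X (Sum.inl i) ∈ A k) + ind (X (Sum.inr i) ∈ A k)) / 18
        = (5/18) * ind (X (swapPerm s (Sum.inr i)) ∈ A k)
          - (7/18) * ind (X (swapPerm s (Sum.inl i)) ∈ A k) := by
      intro i
      by_cases h : s i = true
      · simp [swapPerm, swapFun, h]; ring
      · simp [swapPerm, swapFun, h]; ring
    rw [Finset.sum_congr rfl fun i _ => e1 i, Finset.sum_sub_distrib, ← Finset.mul_sum,
      ← Finset.mul_sum]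
    beta_reduce at h1 h2
    have : 0 ≤ n * p0 := by positivity
    linarith
  calc _ ≤ ∑ s : Fin n → Bool, ∑ T ∈ traces A X,
        (∏ i, gfac (ind (Sum.inl i ∈ T)) (ind (Sum.inr i ∈ T)) (s i))
        * Real.exp (-(n * p0 / 36)) := Finset.sum_le_sum fun s _ => step s
    _ = ∑ T ∈ traces A X, (∑ s : Fin n → Bool,
        (∏ i, gfac (ind (Sum.inl i ∈ T)) (ind (Sum.inr i ∈ T)) (s i)))
        * Real.exp (-(n * p0 / 36)) := by
        rw [Finset.sum_comm]; simp only [Finset.sum_mul]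
    _ ≤ ∑ T ∈ traces A X, 2 ^ n * Real.exp (-(n * p0 / 36)) := by
        refine Finset.sum_le_sum fun T _ => ?_
        exact mul_le_mul_of_nonneg_right (sum_prod_gfac T) (Real.exp_pos _).le
    _ = _ := by rw [Finset.sum_const, nsmul_eq_mul]; ring

lemma measurable_ind {Z : Type*} [MeasurableSpace Z] {A : Set Z} (hA : MeasurableSet A) :
    Measurable (fun z => ind (z ∈ A)) := by
  classical
  unfold ind
  exact Measurable.ite hA measurable_const measurable_const

lemma measurableSet_Dset {κ Z : Type*} [Countable κ] [MeasurableSpace Z] (n : ℕ) (p0 : ℝ)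
    (A : κ → Set Z) (hA : ∀ k, MeasurableSet (A k)) : MeasurableSet (Dset n p0 A) := by
  have : Dset n p0 A = ⋃ k, {X | ∑ i, ind (X (Sum.inl i) ∈ A k) < n * p0 / 4 ∧
    n * p0 / 2 ≤ ∑ i, ind (X (Sum.inr i) ∈ A k)} := by
    ext X; simp [Dset]
  rw [this]
  refine MeasurableSet.iUnion fun k => ?_
  have hm : ∀ j : Fin n ⊕ Fin n, Measurable fun X : Fin n ⊕ Fin n → Z => ind (X j ∈ A k) :=
    fun j => (measurable_ind (hA k)).comp (measurable_pi_apply j)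
  refine MeasurableSet.inter ?_ ?_
  · exact measurableSet_lt (Finset.measurable_sum _ fun i _ => hm _) measurable_const
  · exact measurableSet_le measurable_const (Finset.measurable_sum _ fun i _ => hm _)

lemma symm_bound {κ Z : Type*} [Countable κ] [MeasurableSpace Z] (μ : Measure Z)
    [IsProbabilityMeasure μ] (n : ℕ) (p0 : ℝ) (hp : 0 < p0)
    (A : κ → Set Z) (hA : ∀ k, MeasurableSet (A k)) (G : ℝ)
    (hG : ∀ X : Fin n ⊕ Fin n → Z, ((traces A X).card : ℝ) ≤ G) :
    (Measure.pi fun _ : Fin n ⊕ Fin n => μ) (Dset n p0 A) ≤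
      ENNReal.ofReal (G * Real.exp (-(n * p0 / 36))) := by
  have hD := measurableSet_Dset n p0 A hA
  set ν := Measure.pi fun _ : Fin n ⊕ Fin n => μ
  have h1 : ∀ s : Fin n → Bool,
      ν (Dset n p0 A) = ∫⁻ X, ENNReal.ofReal (ind ((fun j => X (swapPerm s j)) ∈ Dset n p0 A)) ∂ν := by
    intro s
    have hmp := measurePreserving_perm μ (swapPerm s)
    rw [← hmp.measure_preimage hD.nullMeasurableSet, ← lintegral_indicator_one (hmp.measurable hD)]
    refine lintegral_congr fun X => ?_
    by_cases h : (fun j => X (swapPerm s j)) ∈ Dset n p0 A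
    · rw [ind_pos h, Set.indicator_of_mem (by exact h)]; simp
    · rw [ind_neg h, Set.indicator_of_notMem (by exact h)]; simp
  have h2 : (2:ENNReal) ^ n * ν (Dset n p0 A) ≤
      2 ^ n * ENNReal.ofReal (G * Real.exp (-(n * p0 / 36))) := by
    calc (2:ENNReal) ^ n * ν (Dset n p0 A) = ∑ s : Fin n → Bool, ν (Dset n p0 A) := by
          simp
      _ = ∑ s : Fin n → Bool,
          ∫⁻ X, ENNReal.ofReal (ind ((fun j => X (swapPerm s j)) ∈ Dset n p0 A)) ∂ν :=
          Finset.sum_congr rfl fun s _ => h1 s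
      _ = ∫⁻ X, ∑ s : Fin n → Bool,
          ENNReal.ofReal (ind ((fun j => X (swapPerm s j)) ∈ Dset n p0 A)) ∂ν := by
          rw [lintegral_finsetSum]
          intro s _
          exact ((measurable_ind hD).comp (measurePreserving_perm μ (swapPerm s)).measurable).ennreal_ofReal
      _ ≤ ∫⁻ X, 2 ^ n * ENNReal.ofReal (G * Real.exp (-(n * p0 / 36))) ∂ν := by
          refine lintegral_mono fun X => ?_
          simp only
          rw [← ENNReal.ofReal_sum_of_nonneg fun s _ => ind_nonneg _]
          have : (2:ENNReal) ^ n = ENNReal.ofReal (2 ^ n) := by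
            rw [ENNReal.ofReal_pow (by norm_num)]; simp
          rw [this, ← ENNReal.ofReal_mul (by positivity)]
          apply ENNReal.ofReal_le_ofReal
          refine (pointwise_bound n p0 hp A X).trans ?_
          have := hG X
          gcongr
      _ = _ := by simp [ν]
  exact (ENNReal.mul_le_mul_iff_right (by simp) (by simp)).1 h2

lemma ghost {Z : Type*} [MeasurableSpace Z] (μ : Measure Z) [IsProbabilityMeasure μ] (n : ℕ)
    (p0 : ℝ) (hn : 10 ≤ n * p0) (A : Set Z) (hA : MeasurableSet A)
    (hp : ENNReal.ofReal p0 ≤ μ A) :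
    (2⁻¹ : ENNReal) ≤ (Measure.pi fun _ : Fin n => μ) {X | n * p0 / 2 ≤ ∑ i, ind (X i ∈ A)} := by
  set ν := Measure.pi fun _ : Fin n => μ
  have hmi : ∀ i : Fin n, Measurable fun X : Fin n → Z => ind (X i ∈ A) :=
    fun j => (measurable_ind hA).comp (measurable_pi_apply j)
  have hms : Measurable fun X : Fin n → Z => ∑ i, ind (X i ∈ A) :=
    Finset.measurable_sum _ fun i _ => hmi i
  have hS : MeasurableSet {X : Fin n → Z | n * p0 / 2 ≤ ∑ i, ind (X i ∈ A)} :=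
    measurableSet_le measurable_const hms
  have hpr : p0 ≤ μ.real A := by
    rw [Measure.real]
    exact (ENNReal.ofReal_le_iff_le_toReal (measure_ne_top μ A)).1 hp
  have he1 : Real.exp (-1) ≤ 0.4 := by
    have := Real.exp_neg_one_lt_d9; norm_num at *; linarith
  have hone : ∫ z, Real.exp (-ind (z ∈ A)) ∂μ = 1 - (1 - Real.exp (-1)) * μ.real A := by
    have : ∀ z, Real.exp (-ind (z ∈ A)) = 1 - (1 - Real.exp (-1)) * A.indicator (1 : Z → ℝ) z := by
      intro z
      by_cases h : z ∈ A
      · rw [ind_pos h, Set.indicator_of_mem h]; simp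
      · rw [ind_neg h, Set.indicator_of_notMem h]; simp
    simp_rw [this]
    have hi1 : Integrable (A.indicator (1 : Z → ℝ)) μ := (integrable_const (1:ℝ)).indicator hA
    rw [integral_sub (integrable_const _) (hi1.const_mul _), integral_const_mul,
      integral_indicator_one hA]
    simp
  have hint : ∫ X, Real.exp (-∑ i, ind (X i ∈ A)) ∂ν ≤ Real.exp (-(0.6 * (n * p0))) := by
    have : ∀ X : Fin n → Z, Real.exp (-∑ i, ind (X i ∈ A)) = ∏ i, Real.exp (-ind (X i ∈ A)) := by
      intro X
      rw [← Real.exp_sum, Finset.sum_neg_distrib]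
    simp_rw [this]
    have h3 := integral_fintype_prod_eq_pow (ι := Fin n) (𝕜 := ℝ) (μ := μ)
      (fun z => Real.exp (-ind (z ∈ A)))
    simp only [ν]
    rw [h3, hone, Fintype.card_fin]
    have h4 : 1 - (1 - Real.exp (-1)) * μ.real A ≤ Real.exp (-(0.6 * p0)) := by
      have := Real.add_one_le_exp (-(0.6 * p0))
      have hn : 0 ≤ μ.real A := measureReal_nonneg
      nlinarith
    have h5 : 0 ≤ 1 - (1 - Real.exp (-1)) * μ.real A := by
      have : μ.real A ≤ 1 := measureReal_le_one
      have : 0 ≤ μ.real A := measureReal_nonneg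
      nlinarith [Real.exp_pos (-1)]
    calc _ ≤ Real.exp (-(0.6 * p0)) ^ n := pow_le_pow_left₀ h5 h4 n
      _ = _ := by rw [← Real.exp_nat_mul]; ring_nf
  have hintg : Integrable (fun X : Fin n → Z => Real.exp (-∑ i, ind (X i ∈ A))) ν := by
    refine Integrable.of_bound (C := 1) (Real.measurable_exp.comp hms.neg).aestronglyMeasurable
      (Filter.Eventually.of_forall fun X => ?_)
    rw [Real.norm_eq_abs, abs_of_pos (Real.exp_pos _)]
    apply Real.exp_le_one_iff.2
    have : 0 ≤ ∑ i, ind (X i ∈ A) := Finset.sum_nonneg fun i _ => ind_nonneg _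
    linarith
  have hmk := mul_meas_ge_le_integral_of_nonneg
    (Filter.Eventually.of_forall fun X => (Real.exp_pos _).le) hintg (Real.exp (-(n * p0 / 2)))
  have hsub : {X : Fin n → Z | n * p0 / 2 ≤ ∑ i, ind (X i ∈ A)}ᶜ ⊆
      {X | Real.exp (-(n * p0 / 2)) ≤ Real.exp (-∑ i, ind (X i ∈ A))} := by
    intro X hX
    simp only [Set.mem_compl_iff, Set.mem_ofPred_eq, not_le] at hX ⊢
    apply Real.exp_le_exp.2
    linarith
  have hc : ν.real {X : Fin n → Z | n * p0 / 2 ≤ ∑ i, ind (X i ∈ A)}ᶜ ≤ 1 / 2 := by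
    have h6 := measureReal_mono (μ := ν) hsub
    have h7 : Real.exp (-(n * p0 / 2)) *
        ν.real {X : Fin n → Z | n * p0 / 2 ≤ ∑ i, ind (X i ∈ A)}ᶜ ≤ Real.exp (-(n * p0 / 2)) * (1/2) := by
      refine (mul_le_mul_of_nonneg_left h6 (Real.exp_pos _).le).trans (hmk.trans (hint.trans ?_))
      have : Real.exp (-(0.6 * (n * p0))) = Real.exp (-(n * p0 / 2)) * Real.exp (-(0.1 * (n * p0))) := by
        rw [← Real.exp_add]; ring_nf
      rw [this]
      refine mul_le_mul_of_nonneg_left ?_ (Real.exp_pos _).le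
      have : Real.exp (-(0.1 * (n * p0))) ≤ Real.exp (-1) := Real.exp_le_exp.2 (by linarith)
      linarith
    exact le_of_mul_le_mul_left h7 (Real.exp_pos _)
  rw [measureReal_compl hS] at hc
  simp only [probReal_univ] at hc
  have h8 : (1/2 : ℝ) ≤ ν.real {X : Fin n → Z | n * p0 / 2 ≤ ∑ i, ind (X i ∈ A)} := by linarith
  rw [Measure.real] at h8
  have := (ENNReal.ofReal_le_iff_le_toReal (measure_ne_top _ _)).2 h8
  refine le_trans (le_of_eq ?_) this
  rw [one_div, ENNReal.ofReal_inv_of_pos (by norm_num)]; simp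

lemma bad_bound {κ Z : Type*} [Countable κ] [MeasurableSpace Z] (μ : Measure Z)
    [IsProbabilityMeasure μ] (n : ℕ) (p0 : ℝ) (hp : 0 < p0) (hn : 10 ≤ n * p0)
    (A : κ → Set Z) (hA : ∀ k, MeasurableSet (A k)) (hμ : ∀ k, ENNReal.ofReal p0 ≤ μ (A k)) (G : ℝ)
    (hG : ∀ X : Fin n ⊕ Fin n → Z, ((traces A X).card : ℝ) ≤ G) :
    (Measure.pi fun _ : Fin n => μ) {X | ∃ k, ∑ i, ind (X i ∈ A k) < n * p0 / 4} ≤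
      ENNReal.ofReal (2 * (G * Real.exp (-(n * p0 / 36)))) := by
  have hs := symm_bound μ n p0 hp A hA G hG
  have hD := measurableSet_Dset n p0 A hA
  have hmp := measurePreserving_sumPiEquivProdPi_symm (fun _ : Fin n ⊕ Fin n => μ)
  rw [← hmp.measure_preimage hD.nullMeasurableSet] at hs
  have hD' := hmp.measurable hD
  rw [Measure.prod_apply hD'] at hs
  have hmk := mul_meas_ge_le_lintegral (μ := Measure.pi fun _ : Fin n => μ)
    (measurable_measure_prodMk_left (ν := Measure.pi fun _ : Fin n => μ) hD') 2⁻¹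
  have hsub : {X : Fin n → Z | ∃ k, ∑ i, ind (X i ∈ A k) < n * p0 / 4} ⊆
      {X | (2⁻¹ : ENNReal) ≤ (Measure.pi fun _ : Fin n => μ) (Prod.mk X ⁻¹'
        ((MeasurableEquiv.sumPiEquivProdPi fun _ : Fin n ⊕ Fin n => Z).symm ⁻¹' Dset n p0 A))} := by
    rintro X ⟨k, hk⟩
    refine (ghost μ n p0 hn (A k) (hA k) (hμ k)).trans (measure_mono ?_)
    intro Y hY
    exact ⟨k, hk, hY⟩
  have h1 := (mul_le_mul_right (measure_mono (μ := Measure.pi fun _ : Fin n => μ) hsub) 2⁻¹).trans (hmk.trans hs)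
  have h2 := mul_le_mul_right h1 2
  rw [← mul_assoc, ENNReal.mul_inv_cancel (by simp) (by simp), one_mul] at h2
  refine h2.trans (le_of_eq ?_)
  rw [ENNReal.ofReal_mul (by norm_num : (0:ℝ) ≤ 2)]; simp

lemma growth_bound (m D : ℕ) (x : ℝ) (hx : 0 < x) (hx1 : x ≤ 1) :
    ((∑ k ∈ Finset.Iic D, m.choose k : ℕ) : ℝ) ≤ (x⁻¹) ^ D * Real.exp (m * x) := by
  have h1 : x ^ D * ((∑ k ∈ Finset.Iic D, m.choose k : ℕ) : ℝ) ≤ Real.exp (m * x) := by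
    calc x ^ D * ((∑ k ∈ Finset.Iic D, m.choose k : ℕ) : ℝ)
        ≤ ∑ k ∈ Finset.Iic D, x ^ k * (m.choose k : ℝ) := by
          push_cast
          rw [Finset.mul_sum]
          refine Finset.sum_le_sum fun k hk => ?_
          exact mul_le_mul_of_nonneg_right
            (pow_le_pow_of_le_one hx.le hx1 (Finset.mem_Iic.1 hk)) (by positivity)
      _ ≤ ∑ k ∈ Finset.range (D + m + 1), x ^ k * (m.choose k : ℝ) := by
          refine Finset.sum_le_sum_of_subset_of_nonneg ?_ fun k _ _ => by positivity
          intro k hk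
          simp at hk ⊢; omega
      _ = ∑ k ∈ Finset.range (m + 1), x ^ k * (m.choose k : ℝ) := by
          symm
          refine Finset.sum_subset (fun k hk => by simp at hk ⊢; omega) fun k _ hk => ?_
          rw [Nat.choose_eq_zero_of_lt (by simpa using hk)]; simp
      _ = (x + 1) ^ m := by rw [add_pow]; simp
      _ ≤ Real.exp x ^ m := pow_le_pow_left₀ (by positivity) (Real.add_one_le_exp x) m
      _ = _ := by rw [← Real.exp_nat_mul]
  rw [inv_pow, inv_mul_eq_div, le_div_iff₀ (by positivity)]
  linarith

/-- The error region of the classifier `(a, b)`. -/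
def errSet {d : ℕ} (k : ℝ × (Fin d → ℝ)) : Set ((Fin d → ℝ) × ℝ) :=
  {q | q.2 = -sgn (k.1 + dotp k.2 q.1)}

lemma measurableSet_errSet {d : ℕ} (k : ℝ × (Fin d → ℝ)) : MeasurableSet (errSet k) := by
  refine measurableSet_eq_fun measurable_snd ?_
  have h : Measurable fun q : (Fin d → ℝ) × ℝ => k.1 + dotp k.2 q.1 := by
    unfold dotp; fun_prop
  refine Measurable.neg ?_
  unfold sgn
  exact Measurable.ite (measurableSet_le measurable_const h) measurable_const measurable_const

lemma sgn_cases (u : ℝ) : sgn u = 1 ∨ sgn u = -1 := by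
  unfold sgn; split_ifs <;> simp

open Classical in
lemma vc_bound {κ : Type*} {d : ℕ} {ι : Type*} [Fintype ι] (f : κ → ℝ × (Fin d → ℝ))
    (X : ι → (Fin d → ℝ) × ℝ) :
    (traces (fun k => errSet (f k)) X).vcDim ≤ d + 1 := by
  refine Finset.sup_le fun s hs => ?_
  rw [Finset.mem_shatterer] at hs
  by_contra hcard
  push Not at hcard
  let v : s → ℝ × (Fin d → ℝ) := fun j => (1, (X j).1)
  have hnl : ¬ LinearIndependent ℝ v := by
    intro h
    have := h.fintype_card_le_finrank
    simp [Module.finrank_prod] at this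
    omega
  obtain ⟨g0, hg0, i0, hi0⟩ := Fintype.not_linearIndependent_iff.1 hnl
  obtain ⟨g, hg, i, hi⟩ : ∃ g : s → ℝ, ∑ j, g j • v j = 0 ∧ ∃ i, g i < 0 := by
    rcases lt_or_gt_of_ne hi0 with h | h
    · exact ⟨g0, hg0, i0, h⟩
    · refine ⟨fun j => -g0 j, ?_, i0, by simpa using h⟩
      simp only [neg_smul, Finset.sum_neg_distrib, hg0, neg_zero]
  have hdot : ∀ k : ℝ × (Fin d → ℝ), ∑ j, g j * (k.1 + dotp k.2 (X j).1) = 0 := by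
    intro k
    have h1 : ∑ j, g j = 0 := by
      simpa [v, Prod.fst_sum] using congrArg Prod.fst hg
    have h2 : ∀ l, ∑ j, g j * (X j).1 l = 0 := by
      intro l
      simpa [v, Prod.snd_sum] using congrFun (congrArg Prod.snd hg) l
    simp only [mul_add, Finset.sum_add_distrib, ← Finset.sum_mul, h1, dotp, Finset.mul_sum]
    rw [Finset.sum_comm]
    simp only [zero_mul, zero_add]
    refine Finset.sum_eq_zero fun l _ => ?_
    rw [show ∑ j, g j * (k.2 l * (X j).1 l) = k.2 l * ∑ j, g j * (X j).1 l by
      rw [Finset.mul_sum]; exact Finset.sum_congr rfl fun j _ => by ring, h2, mul_zero]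
  let t : Finset ι := s.filter fun j => ∃ h : j ∈ s, (X j).2 = -sgn (g ⟨j, h⟩)
  have hy : ∀ j ∈ s, (X j).2 = 1 ∨ (X j).2 = -1 := by
    intro j hj
    obtain ⟨u, hu, hsu⟩ := hs (Finset.Subset.refl s)
    simp only [traces, Finset.mem_filter, Finset.mem_univ, true_and] at hu
    obtain ⟨k, hk⟩ := hu
    have hju : j ∈ u := Finset.inter_eq_left.1 hsu hj
    have := (hk j).1 hju
    simp only [errSet, Set.mem_ofPred_eq] at this
    rcases sgn_cases ((f k).1 + dotp (f k).2 (X j).1) with h | h <;> rw [h] at this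
    · exact Or.inr this
    · left; simpa using this
  obtain ⟨u, hu, hsu⟩ := hs (Finset.filter_subset _ s : t ⊆ s)
  simp only [traces, Finset.mem_filter, Finset.mem_univ, true_and] at hu
  obtain ⟨k, hk⟩ := hu
  have hsg : ∀ j : s, sgn (g j) = sgn ((f k).1 + dotp (f k).2 (X j).1) := by
    rintro ⟨j, hj⟩
    have h1 : j ∈ t ↔ X j ∈ errSet (f k) := by
      rw [show t = s ∩ u from hsu.symm, ← hk j]; simp [hj]
    have h2 : j ∈ t ↔ (X j).2 = -sgn (g ⟨j, hj⟩) := by simp [t, hj]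
    rw [h2] at h1
    simp only [errSet, Set.mem_ofPred_eq] at h1
    rcases hy j hj with h | h <;> rcases sgn_cases (g ⟨j, hj⟩) with h' | h' <;>
      rcases sgn_cases ((f k).1 + dotp (f k).2 (X j).1) with h'' | h'' <;>
      rw [h, h', h''] at h1 <;> rw [h', h''] <;> norm_num at h1
  have hpos : 0 < ∑ j, g j * ((f k).1 + dotp (f k).2 (X j).1) := by
    have key : ∀ j : s, (g j < 0 → 0 < g j * ((f k).1 + dotp (f k).2 (X j).1)) ∧
        0 ≤ g j * ((f k).1 + dotp (f k).2 (X j).1) := by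
      intro j
      have := hsg j
      unfold sgn at this
      split_ifs at this with h1 h2 h2
      · exact ⟨fun h => absurd h1 (not_le.2 h), mul_nonneg h1 h2⟩
      · norm_num at this
      · norm_num at this
      · have := mul_pos_of_neg_of_neg (not_le.1 h1) (not_le.1 h2)
        exact ⟨fun _ => this, this.le⟩
    exact Finset.sum_pos' (fun j _ => (key j).2) ⟨i, Finset.mem_univ _, (key i).1 hi⟩
  rw [hdot] at hpos
  exact lt_irrefl _ hpos

lemma card_traces {κ : Type*} {d n : ℕ} (f : κ → ℝ × (Fin d → ℝ))
    (X : Fin n ⊕ Fin n → (Fin d → ℝ) × ℝ) (x : ℝ) (hx : 0 < x) (hx1 : x ≤ 1) :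
    ((traces (fun k => errSet (f k)) X).card : ℝ) ≤
      (x⁻¹) ^ (d + 1) * Real.exp ((2 * n : ℕ) * x) := by
  classical
  refine le_trans ?_ (growth_bound (2 * n) (d + 1) x hx hx1)
  norm_cast
  refine (Finset.card_le_card_shatterer _).trans (Finset.card_shatterer_le_sum_vcDim.trans ?_)
  have hc : Fintype.card (Fin n ⊕ Fin n) = 2 * n := by simp; ring
  rw [hc]
  refine Finset.sum_le_sum_of_subset (Finset.Iic_subset_Iic.2 ?_)
  have h := vc_bound f X
  convert h using 0
  congr!

/-- Rational parameters. -/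
def ratPar {d : ℕ} (k : ℚ × (Fin d → ℚ)) : ℝ × (Fin d → ℝ) := (k.1, fun i => (k.2 i : ℝ))

lemma exists_rat {d n : ℕ} (x : Fin n → (Fin d → ℝ)) (a : ℝ) (b : Fin d → ℝ) :
    ∃ k : ℚ × (Fin d → ℚ), ∀ i, sgn ((ratPar k).1 + dotp (ratPar k).2 (x i)) =
      sgn (a + dotp b (x i)) := by
  obtain ⟨ε, hε0, hε⟩ : ∃ ε : ℝ, 0 < ε ∧ ∀ i, a + dotp b (x i) < 0 → a + ε + dotp b (x i) < 0 := by
    have h1 : ∀ i, ∀ᶠ ε : ℝ in nhdsWithin 0 (Set.Ioi 0),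
        (a + dotp b (x i) < 0 → a + ε + dotp b (x i) < 0) := by
      intro i
      by_cases h : a + dotp b (x i) < 0
      · have hc : Continuous fun ε : ℝ => a + ε + dotp b (x i) := by fun_prop
        have := hc.continuousAt.eventually_lt (continuousAt_const (y := (0:ℝ)) (x := (0:ℝ)))
          (by simpa using h)
        exact (this.filter_mono nhdsWithin_le_nhds).mono fun ε h _ => h
      · exact Filter.Eventually.of_forall fun _ h' => absurd h' h
    have h2 := (Filter.eventually_all.2 h1).and self_mem_nhdsWithin
    obtain ⟨ε, h3, h4⟩ := h2.exists
    exact ⟨ε, h4, h3⟩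
  let U : Set (ℝ × (Fin d → ℝ)) := ⋂ i, {k | (a + dotp b (x i) < 0 → k.1 + dotp k.2 (x i) < 0) ∧
    (0 ≤ a + dotp b (x i) → 0 < k.1 + dotp k.2 (x i))}
  have hU : IsOpen U := by
    refine isOpen_iInter_of_finite fun i => ?_
    have hc : Continuous fun k : ℝ × (Fin d → ℝ) => k.1 + dotp k.2 (x i) := by
      unfold dotp; fun_prop
    by_cases h : a + dotp b (x i) < 0
    · simp only [h, not_le.2 h, true_imp_iff, false_imp_iff, and_true]
      exact isOpen_lt hc continuous_const
    · simp only [h, not_lt.1 h, true_imp_iff, false_imp_iff, true_and]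
      exact isOpen_lt continuous_const hc
  have hne : U.Nonempty := by
    refine ⟨(a + ε, b), Set.mem_iInter.2 fun i => ⟨hε i, fun h => ?_⟩⟩
    simp only
    linarith
  have hd : DenseRange (ratPar (d := d)) :=
    (Rat.denseRange_cast (𝕜 := ℝ)).prodMap (DenseRange.piMap fun _ => Rat.denseRange_cast (𝕜 := ℝ))
  obtain ⟨k, hk⟩ := hd.exists_mem_open hU hne
  refine ⟨k, fun i => ?_⟩
  obtain ⟨h1, h2⟩ := Set.mem_iInter.1 hk i
  unfold sgn
  by_cases h : a + dotp b (x i) < 0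
  · rw [if_neg (not_le.2 h), if_neg (not_le.2 (h1 h))]
  · rw [if_pos (not_lt.1 h), if_pos (h2 (not_lt.1 h)).le]

/-- **Lemma A.2 (core)**: if every affine classifier misclassifies with probability at
least `p₀`, then with high probability every affine classifier misclassifies at least
a `p₀/4` fraction of `n ≥ C d / p₀²` i.i.d. samples. -/
theorem affine_misclassification_lower_bound :
    ∃ C c : ℝ, 0 < C ∧ 0 < c ∧
      ∀ (d n : ℕ), 1 ≤ d → 1 ≤ n → ∀ p0 : ℝ, 0 < p0 → p0 ≤ 1 / 2 →
      ∀ μ : Measure ((Fin d → ℝ) × ℝ), IsProbabilityMeasure μ →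
        μ {q | q.2 = 1 ∨ q.2 = -1} = 1 →
        (∀ (a : ℝ) (b : Fin d → ℝ),
          ENNReal.ofReal p0 ≤ μ {q | q.2 = -sgn (a + dotp b q.1)}) →
        C * d / p0 ^ 2 ≤ (n : ℝ) →
        1 - ENNReal.ofReal (C * Real.exp (-(c * n * p0 ^ 2))) ≤
          (Measure.pi fun _ : Fin n => μ)
            {X | ∀ (a : ℝ) (b : Fin d → ℝ),
              p0 / 4 ≤ (1 / (n : ℝ)) *
                ∑ i, ind ((X i).2 = -sgn (a + dotp b (X i).1))} := by
  refine ⟨82944, 1 / 72, by norm_num, by norm_num, ?_⟩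
  intro d n hd hn p0 hp0 hp1 μ hμ _ herr hC
  have hd1 : (1:ℝ) ≤ d := by exact_mod_cast hd
  have hn1 : (1:ℝ) ≤ n := by exact_mod_cast hn
  have hnp : 82944 * d / p0 ≤ n * p0 := by
    rw [div_le_iff₀ (by positivity)] at hC ⊢
    nlinarith
  have hnp10 : 10 ≤ n * p0 := by
    refine le_trans ?_ hnp
    rw [le_div_iff₀ hp0]
    linarith
  set x : ℝ := p0 / 288 with hx
  have hx0 : 0 < x := by positivity
  have hx1 : x ≤ 1 := by rw [hx]; linarith
  have hb := bad_bound μ n p0 hp0 hnp10 (fun k : ℚ × (Fin d → ℚ) => errSet (ratPar k))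
    (fun k => measurableSet_errSet _) (fun k => herr _ _) _
    (fun X => card_traces ratPar X x hx0 hx1)
  have hfin : 2 * (x⁻¹ ^ (d + 1) * Real.exp ((2 * n : ℕ) * x) * Real.exp (-(n * p0 / 36))) ≤
      82944 * Real.exp (-(1 / 72 * n * p0 ^ 2)) := by
    have h1 : x⁻¹ ^ (d + 1) ≤ Real.exp (n * p0 / 144) := by
      have h2 : x⁻¹ ≤ Real.exp (288 / p0) := by
        have := Real.add_one_le_exp (288 / p0)
        rw [hx, inv_div]; linarith
      calc x⁻¹ ^ (d + 1) ≤ Real.exp (288 / p0) ^ (d + 1) :=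
            pow_le_pow_left₀ (by positivity) h2 _
        _ = Real.exp ((d + 1 : ℕ) * (288 / p0)) := by rw [Real.exp_nat_mul]
        _ ≤ _ := by
          apply Real.exp_le_exp.2
          have h3 : ((d + 1 : ℕ) : ℝ) * (288 / p0) ≤ (2 * d) * (288 / p0) := by
            refine mul_le_mul_of_nonneg_right ?_ (by positivity)
            push_cast; linarith
          have h4 : (2 * (d:ℝ)) * (288 / p0) = (82944 * d / p0) / 144 := by ring
          linarith
    have h5 : x⁻¹ ^ (d + 1) * Real.exp ((2 * n : ℕ) * x) * Real.exp (-(n * p0 / 36)) ≤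
        Real.exp (-(1 / 72 * n * p0 ^ 2)) := by
      calc _ ≤ Real.exp (n * p0 / 144) * Real.exp ((2 * n : ℕ) * x) *
            Real.exp (-(n * p0 / 36)) := by gcongr
        _ = Real.exp (-(1 / 72 * (n * p0))) := by
          rw [← Real.exp_add, ← Real.exp_add, hx]; push_cast; ring_nf
        _ ≤ _ := by
          apply Real.exp_le_exp.2
          nlinarith
    nlinarith [Real.exp_pos (-(1 / 72 * n * p0 ^ 2))]
  set ν := Measure.pi fun _ : Fin n => μ
  rw [tsub_le_iff_right]
  calc (1 : ENNReal) = ν Set.univ := by simp [ν]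
    _ ≤ ν (_ ∪ _) := measure_mono ?_
    _ ≤ ν _ + ν _ := measure_union_le _ _
    _ ≤ _ := by
      gcongr
      exact hb.trans (ENNReal.ofReal_le_ofReal hfin)
  intro X _
  by_cases hX : ∃ k : ℚ × (Fin d → ℚ), ∑ i, ind (X i ∈ errSet (ratPar k)) < n * p0 / 4
  · exact Or.inr hX
  · left
    intro a b
    obtain ⟨k, hk⟩ := exists_rat (fun i => (X i).1) a b
    have h1 : n * p0 / 4 ≤ ∑ i, ind (X i ∈ errSet (ratPar k)) := by
      by_contra h
      exact hX ⟨k, not_le.1 h⟩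
    have h2 : ∑ i, ind ((X i).2 = -sgn (a + dotp b (X i).1)) =
        ∑ i, ind (X i ∈ errSet (ratPar k)) := by
      refine Finset.sum_congr rfl fun i _ => ?_
      rw [← hk i]; rfl
    rw [h2, one_div, inv_mul_eq_div, le_div_iff₀ (by positivity)]
    linarith
end
end
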